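/- arXiv:math/0510508 — 2 statements merged into one kernel-verified Lean document; each statement's English description precedes it below -/
import Mathlib

section
/- Let k be a field, B an associative unital k-algebra, N ≥ 1 an integer, and c : B^{⊗N} → B a k-linear map. Let A = B[ε]/(ε²) with ε placed in degree 2−N, viewed as a graded vector space, equipped with the operations b'_n defined by: b'_2 is the map induced by the multiplication of B (with the standard sign twist on the suspension), b'_N is modified by adding ε·c (i.e. b'_N = b_N + εc, where b_N = 0 if N ≠ 2), and b'_n = b_n (i.e. b'_n = 0 for n ∉ {2, N}, and b'_2 is unchanged if N ≠ 2). Then A endowed with the operations b'_n is an A∞-algebra if and only if c is a Hochschild N-cocycle for B. -/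
/-!
# Statement 0

Let `k` be a field, `B` an associative unital `k`-algebra, `N ≥ 1`, and
`c : B^{⊗N} → B` a `k`-linear (i.e. `k`-multilinear) map.  Let `A = B[ε]/(ε²)` with `ε`
in degree `2 - N`; we realize `A` as `B × B` (second component = coefficient of `ε`).
All gradings below are gradings of the *suspension* `SA` (so an element of `A^d`
sits in degree `d - 1`): the copy `B ⊂ A` (degree `0` in `A`) sits in degree `-1`,
and `B·ε` (degree `2 - N` in `A`) sits in degree `1 - N`.

An A∞-algebra structure on a graded space is a family of multilinear operations
`b n : (SA)^{⊗ n} → SA`, homogeneous of degree `1`, satisfying the A∞-relations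
`∑_{i+j+l=n} b_{i+1+l} ∘ (1^{⊗i} ⊗ b_j ⊗ 1^{⊗l}) = 0` (with the Koszul sign rule,
which on homogeneous arguments produces the sign `(-1)^{p_1 + ⋯ + p_i}`, `|b_j| = 1`).

The deformed operations: `b'_2` is induced by the multiplication of `B[ε]/(ε²)`
(with the standard sign twist on the suspension), and `b'_N` acquires the extra
term `ε·c`; `b'_n = 0` for `n ∉ {2, N}`.

The theorem: `A` with the operations `b'` is an A∞-algebra iff `c` is a Hochschild
`N`-cocycle for `B` (standard alternating-sum Hochschild differential).
-/

open Finset Function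

namespace Stmt0

variable (k : Type) [Field k]

/-- An `n`-ary operation is `k`-multilinear (i.e. corresponds to a `k`-linear map on the
`n`-th tensor power). -/
def IsMultilinear {M N : Type} [AddCommGroup M] [Module k M] [AddCommGroup N] [Module k N]
    {n : ℕ} (f : (Fin n → M) → N) : Prop :=
  (∀ (v : Fin n → M) (i : Fin n) (x y : M),
      f (Function.update v i (x + y)) = f (Function.update v i x) + f (Function.update v i y)) ∧
  (∀ (v : Fin n → M) (i : Fin n) (a : k) (x : M),
      f (Function.update v i (a • x)) = a • f (Function.update v i x))

/-- The tuple `(v_1, …, v_i, x, v_{i+j+1}, …, v_n)` obtained from `v` by replacing the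
`j` entries `v_{i+1}, …, v_{i+j}` by the single entry `x`.  (Out-of-range indices, which
never occur for `i + j ≤ n`, are filled with `0`.) -/
def insArg {M : Type} [Zero M] (n i j : ℕ) (v : Fin n → M) (x : M) :
    Fin (i + 1 + (n - i - j)) → M := fun t =>
  if h : (t : ℕ) < i ∧ (t : ℕ) < n then v ⟨t, h.2⟩
  else if (t : ℕ) = i then x
  else if h2 : (t : ℕ) + j - 1 < n then v ⟨(t : ℕ) + j - 1, h2⟩ else 0

/-- The tuple `(v_{i+1}, …, v_{i+j})`. -/
def shiftArg {M : Type} [Zero M] (n i j : ℕ) (v : Fin n → M) : Fin j → M := fun t =>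
  if h : i + (t : ℕ) < n then v ⟨i + t, h⟩ else 0

/-- The Koszul sign exponent `p_1 + ⋯ + p_i` (degrees of the first `i` arguments). -/
def partialDeg (n i : ℕ) (p : Fin n → ℤ) : ℤ :=
  ∑ t ∈ Finset.range i, if h : t < n then p ⟨t, h⟩ else 0

/-- `b` is an A∞-algebra structure on the graded space `(M, gr)` (where `gr` is the grading
of the suspension): the operations are multilinear, homogeneous of degree `1`, defined for
`n ≥ 1`, and satisfy the A∞-relations (with Koszul signs) on homogeneous arguments. -/
def IsAInfinity (M : Type) [AddCommGroup M] [Module k M] (gr : ℤ → Submodule k M)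
    (b : ∀ n : ℕ, (Fin n → M) → M) : Prop :=
  b 0 = 0 ∧
  (∀ n, IsMultilinear k (b n)) ∧
  (∀ (n : ℕ) (p : Fin n → ℤ) (v : Fin n → M),
      (∀ t, v t ∈ gr (p t)) → b n v ∈ gr (1 + ∑ t, p t)) ∧
  (∀ (n : ℕ), 1 ≤ n → ∀ (p : Fin n → ℤ) (v : Fin n → M), (∀ t, v t ∈ gr (p t)) →
      ∑ i ∈ Finset.range n, ∑ j ∈ Finset.Icc 1 (n - i),
        ((-1 : k) ^ partialDeg n i p) •
          b (i + 1 + (n - i - j)) (insArg n i j v (b j (shiftArg n i j v))) = 0)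

variable (B : Type) [Ring B] [Algebra k B]

/-- The grading (of the suspension) of `A = B[ε]/(ε²) = B ⊕ B·ε`: the copy of `B` sits in
degree `-1` and `B·ε` sits in degree `1 - N`. -/
def grA (N : ℕ) : ℤ → Submodule k (B × B) := fun d =>
  (if d = -1 then Submodule.prod (⊤ : Submodule k B) (⊥ : Submodule k B) else ⊥) ⊔
    (if d = 1 - (N : ℤ) then Submodule.prod (⊥ : Submodule k B) (⊤ : Submodule k B) else ⊥)

/-- The deformed operations `b'_n` on `A = B ⊕ B·ε`: `b'_2` is induced by the multiplication
of `B[ε]/(ε²)` (with the suspension sign twist), the summand `ε·c` is added to `b'_N`, and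
all other operations vanish. -/
def bOp (N : ℕ) (c : (Fin N → B) → B) : ∀ n : ℕ, (Fin n → B × B) → B × B := fun n v =>
  (if h : n = 2 then
      ((v ⟨0, by omega⟩).1 * (v ⟨1, by omega⟩).1,
        (v ⟨0, by omega⟩).1 * (v ⟨1, by omega⟩).2
          + ((-1 : ℤ) ^ N) • ((v ⟨0, by omega⟩).2 * (v ⟨1, by omega⟩).1))
    else 0)
  + (if h : n = N then ((0 : B), c fun t => (v (Fin.cast h.symm t)).1) else 0)

/-- `c : B^{⊗N} → B` is a Hochschild `N`-cocycle: the standard alternating-sum Hochschild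
differential of `c` vanishes. -/
def IsHochschildCocycle (N : ℕ) (c : (Fin N → B) → B) : Prop :=
  ∀ a : Fin (N + 1) → B,
    a 0 * c (fun t => a t.succ)
      + (∑ i : Fin N, ((-1 : ℤ) ^ ((i : ℕ) + 1)) •
          c (fun t : Fin N =>
            if (t : ℕ) < (i : ℕ) then a t.castSucc
            else if (t : ℕ) = (i : ℕ) then a i.castSucc * a i.succ
            else a t.succ))
      + ((-1 : ℤ) ^ (N + 1)) • (c (fun t => a t.castSucc) * a (Fin.last N)) = 0

section Deformation

variable {k B}

theorem IsMultilinear.eq_zero_of_apply_eq_zero {M N : Type} [AddCommGroup M] [Module k M]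
    [AddCommGroup N] [Module k N] {n : ℕ} {f : (Fin n → M) → N} (hf : IsMultilinear k f)
    {v : Fin n → M} (t : Fin n) (ht : v t = 0) : f v = 0 := by
  have h := hf.2 v t 0 0
  rwa [zero_smul, zero_smul, ← ht, Function.update_eq_self] at h

theorem mem_grA_iff {N : ℕ} {d : ℤ} {x : B × B} :
    x ∈ grA k B N d ↔ (d = -1 ∨ x.1 = 0) ∧ (d = 1 - (N : ℤ) ∨ x.2 = 0) := by
  obtain ⟨x, y⟩ := x
  unfold grA
  rw [Submodule.mem_sup]
  constructor
  · rintro ⟨u, hu, w, hw, h⟩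
    rw [← h]
    split_ifs at hu hw <;> simp_all [Submodule.mem_prod]
  · rintro ⟨h₁, h₂⟩
    refine ⟨(x, 0), ?_, (0, y), ?_, by simp⟩
    · split_ifs with h <;> simp_all [Submodule.mem_prod]
    · split_ifs with h <;> simp_all [Submodule.mem_prod]

/-- The operations of the undeformed algebra `B[ε]/(ε²)`. -/
def mulOp (N n : ℕ) (v : Fin n → B × B) : B × B :=
  if h : n = 2 then
      ((v ⟨0, by omega⟩).1 * (v ⟨1, by omega⟩).1,
        (v ⟨0, by omega⟩).1 * (v ⟨1, by omega⟩).2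
          + ((-1 : ℤ) ^ N) • ((v ⟨0, by omega⟩).2 * (v ⟨1, by omega⟩).1))
    else 0

/-- The infinitesimal deformation `ε·c`. -/
def epsOp (N : ℕ) (c : (Fin N → B) → B) (n : ℕ) (v : Fin n → B × B) : B × B :=
  if h : n = N then ((0 : B), c fun t => (v (Fin.cast h.symm t)).1) else 0

theorem bOp_eq (N : ℕ) (c : (Fin N → B) → B) (n : ℕ) (v : Fin n → B × B) :
    bOp B N c n v = mulOp N n v + epsOp N c n v := rfl

theorem mulOp_of_ne {N n : ℕ} (h : n ≠ 2) (v : Fin n → B × B) : mulOp N n v = 0 := dif_neg h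

theorem epsOp_of_ne {N n : ℕ} (c : (Fin N → B) → B) (h : n ≠ N) (v : Fin n → B × B) :
    epsOp N c n v = 0 := dif_neg h

theorem epsOp_fst (N : ℕ) (c : (Fin N → B) → B) (n : ℕ) (v : Fin n → B × B) :
    (epsOp N c n v).1 = 0 := by
  unfold epsOp; split_ifs <;> rfl

theorem isMultilinear_mulOp (N n : ℕ) : IsMultilinear k (mulOp (B := B) N n) := by
  by_cases h : n = 2
  · subst h
    constructor
    · intro v i x y
      fin_cases i <;>
        simp [mulOp, Function.update, add_mul, mul_add, smul_add] <;> abel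
    · intro v i a x
      fin_cases i <;> simp [mulOp, Function.update]
  · constructor <;> intros <;> simp [mulOp_of_ne h]

theorem isMultilinear_epsOp {N : ℕ} {c : (Fin N → B) → B} (hc : IsMultilinear k c) (n : ℕ) :
    IsMultilinear k (epsOp N c n) := by
  by_cases h : n = N
  · subst h
    have key : ∀ (v : Fin n → B × B) (i : Fin n) (x : B × B),
        epsOp n c n (Function.update v i x) =
          (0, c (Function.update (fun t => (v t).1) i x.1)) := by
      intro v i x
      simp only [epsOp, dif_pos]
      congr 2
      funext t
      by_cases ht : t = i
      · subst ht; simp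
      · simp [ht]
    constructor
    · intro v i x y
      simp [key, hc.1]
    · intro v i a x
      simp [key, hc.2]
  · constructor <;> intros <;> simp [epsOp_of_ne c h]

theorem isMultilinear_bOp {N : ℕ} {c : (Fin N → B) → B} (hc : IsMultilinear k c) (n : ℕ) :
    IsMultilinear k (bOp B N c n) := by
  have h₁ := isMultilinear_mulOp (k := k) (B := B) N n
  have h₂ := isMultilinear_epsOp hc n
  constructor
  · intro v i x y
    rw [bOp_eq, bOp_eq, bOp_eq, h₁.1, h₂.1]; abel
  · intro v i a x
    rw [bOp_eq, bOp_eq, h₁.2, h₂.2, smul_add]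

theorem mulOp_mem_grA {N n : ℕ} {p : Fin n → ℤ} {v : Fin n → B × B}
    (hv : ∀ t, v t ∈ grA k B N (p t)) : mulOp N n v ∈ grA k B N (1 + ∑ t, p t) := by
  by_cases h : n = 2
  · subst h
    obtain ⟨h₁, h₂⟩ := mem_grA_iff.1 (hv 0)
    obtain ⟨h₃, h₄⟩ := mem_grA_iff.1 (hv 1)
    rw [mem_grA_iff, Fin.sum_univ_two]
    simp only [mulOp, dif_pos, Fin.zero_eta, Fin.mk_one]
    constructor
    · rcases h₁ with h₁ | h₁ <;> rcases h₃ with h₃ | h₃ <;> first | (left; omega) | simp [*]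
    · rcases h₁ with h₁ | h₁ <;> rcases h₃ with h₃ | h₃ <;> rcases h₂ with h₂ | h₂ <;>
        rcases h₄ with h₄ | h₄ <;> first | (left; omega) | (right; simp [h₁, h₂, h₃, h₄])
  · rw [mulOp_of_ne h]; exact zero_mem _

theorem epsOp_mem_grA {N n : ℕ} {c : (Fin N → B) → B} (hc : IsMultilinear k c)
    {p : Fin n → ℤ} {v : Fin n → B × B}
    (hv : ∀ t, v t ∈ grA k B N (p t)) : epsOp N c n v ∈ grA k B N (1 + ∑ t, p t) := by
  by_cases h : n = N
  · subst h
    rw [mem_grA_iff]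
    refine ⟨Or.inr (epsOp_fst n c n v), ?_⟩
    simp only [epsOp, dif_pos]
    by_cases hp : ∀ t, p t = -1
    · left; simp [hp]; ring
    · push Not at hp
      obtain ⟨t, ht⟩ := hp
      exact Or.inr (hc.eq_zero_of_apply_eq_zero t
        ((mem_grA_iff.1 (hv t)).1.resolve_left ht))
  · rw [epsOp_of_ne c h]; exact zero_mem _

/-- The `A∞`-composition `∑ ± f ∘ (1^{⊗i} ⊗ g ⊗ 1^{⊗l})` of two families of operations. -/
def compSum (k : Type) [Field k] {M : Type} [AddCommGroup M] [Module k M]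
    (f g : ∀ n : ℕ, (Fin n → M) → M) (n : ℕ) (p : Fin n → ℤ) (v : Fin n → M) : M :=
  ∑ i ∈ Finset.range n, ∑ j ∈ Finset.Icc 1 (n - i),
    ((-1 : k) ^ partialDeg n i p) •
      f (i + 1 + (n - i - j)) (insArg n i j v (g j (shiftArg n i j v)))

theorem insArg_eq_update {M : Type} [Zero M] (n i j : ℕ) (v : Fin n → M) (x : M) :
    insArg n i j v x = Function.update (insArg n i j v 0) ⟨i, by omega⟩ x := by
  funext t
  by_cases h : t = ⟨i, by omega⟩
  · subst h; simp [insArg]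
  · have : (t : ℕ) ≠ i := fun h' => h (Fin.ext h')
    simp [insArg, h, this]

theorem IsMultilinear.map_insArg_add {M N : Type} [AddCommGroup M] [Module k M]
    [AddCommGroup N] [Module k N] {n i j : ℕ} {f : (Fin (i + 1 + (n - i - j)) → M) → N}
    (hf : IsMultilinear k f) (v : Fin n → M) (x y : M) :
    f (insArg n i j v (x + y)) = f (insArg n i j v x) + f (insArg n i j v y) := by
  rw [insArg_eq_update, hf.1, ← insArg_eq_update, ← insArg_eq_update]

theorem IsMultilinear.map_insArg_zero {M N : Type} [AddCommGroup M] [Module k M]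
    [AddCommGroup N] [Module k N] {n i j : ℕ} {f : (Fin (i + 1 + (n - i - j)) → M) → N}
    (hf : IsMultilinear k f) (v : Fin n → M) : f (insArg n i j v 0) = 0 :=
  hf.eq_zero_of_apply_eq_zero ⟨i, by omega⟩ (by simp [insArg])

theorem epsOp_insArg_epsOp {N : ℕ} {c : (Fin N → B) → B} (hc : IsMultilinear k c)
    (n i j : ℕ) (v : Fin n → B × B) (w : Fin j → B × B) :
    epsOp N c (i + 1 + (n - i - j)) (insArg n i j v (epsOp N c j w)) = 0 := by
  unfold epsOp
  split_ifs with h h'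
  · rw [hc.eq_zero_of_apply_eq_zero ⟨i, by omega⟩ (by simp [insArg])]; rfl
  · rw [hc.eq_zero_of_apply_eq_zero ⟨i, by omega⟩ (by simp [insArg])]; rfl
  · rfl

theorem compSum_bOp {N : ℕ} {c : (Fin N → B) → B} (hc : IsMultilinear k c)
    (n : ℕ) (p : Fin n → ℤ) (v : Fin n → B × B) :
    compSum k (bOp B N c) (bOp B N c) n p v =
      compSum k (mulOp N) (mulOp N) n p v +
        (compSum k (mulOp N) (epsOp N c) n p v + compSum k (epsOp N c) (mulOp N) n p v) := by
  unfold compSum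
  simp only [← Finset.sum_add_distrib, ← smul_add]
  refine Finset.sum_congr rfl fun i _ => Finset.sum_congr rfl fun j _ => ?_
  congr 1
  rw [bOp_eq, bOp_eq, (isMultilinear_mulOp (k := k) N _).map_insArg_add,
    (isMultilinear_epsOp hc _).map_insArg_add, epsOp_insArg_epsOp hc]
  abel

theorem sum_range_sum_Icc_eq {M : Type} [AddCommMonoid M] {n m : ℕ} (hm : 1 ≤ m)
    (F : ℕ → ℕ → M) (hF : ∀ i j, j ≠ m → F i j = 0) :
    ∑ i ∈ Finset.range n, ∑ j ∈ Finset.Icc 1 (n - i), F i j =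
      ∑ i ∈ Finset.range (n + 1 - m), F i m := by
  have h : ∀ i ∈ Finset.range n, ∑ j ∈ Finset.Icc 1 (n - i), F i j =
      if i ∈ Finset.range (n + 1 - m) then F i m else 0 := by
    intro i hi
    rw [Finset.mem_range] at hi
    split_ifs with h
    · rw [Finset.mem_range] at h
      refine Finset.sum_eq_single m (fun j _ hj => hF i j hj) fun h' => ?_
      exact absurd (Finset.mem_Icc.2 ⟨hm, by omega⟩) h'
    · rw [Finset.mem_range] at h
      refine Finset.sum_eq_zero fun j hj => hF i j ?_
      rw [Finset.mem_Icc] at hj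
      omega
  rw [Finset.sum_congr rfl h, Finset.sum_ite_mem]
  congr 1
  ext i
  simp only [Finset.mem_inter, Finset.mem_range]
  omega

theorem compSum_eq_of_arity {M : Type} [AddCommGroup M] [Module k M]
    {f g : ∀ n : ℕ, (Fin n → M) → M} (hf : ∀ n, IsMultilinear k (f n)) {m : ℕ} (hm : 1 ≤ m)
    (hg : ∀ j v, j ≠ m → g j v = 0) (n : ℕ) (p : Fin n → ℤ) (v : Fin n → M) :
    compSum k f g n p v = ∑ i ∈ Finset.range (n + 1 - m), ((-1 : k) ^ partialDeg n i p) •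
      f (i + 1 + (n - i - m)) (insArg n i m v (g m (shiftArg n i m v))) := by
  unfold compSum
  refine sum_range_sum_Icc_eq hm (fun i j => ((-1 : k) ^ partialDeg n i p) •
      f (i + 1 + (n - i - j)) (insArg n i j v (g j (shiftArg n i j v)))) fun i j hj => ?_
  rw [hg j _ hj, (hf _).map_insArg_zero, smul_zero]

theorem compSum_eq_zero_of_arity {M : Type} [AddCommGroup M] [Module k M]
    {f g : ∀ n : ℕ, (Fin n → M) → M} (hf : ∀ n, IsMultilinear k (f n)) {m l : ℕ} (hm : 1 ≤ m)
    (hg : ∀ j v, j ≠ m → g j v = 0) (hf' : ∀ j v, j ≠ l → f j v = 0) {n : ℕ}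
    (hn : n + 1 ≠ l + m) (p : Fin n → ℤ) (v : Fin n → M) :
    compSum k f g n p v = 0 := by
  rw [compSum_eq_of_arity hf hm hg]
  refine Finset.sum_eq_zero fun i hi => ?_
  rw [Finset.mem_range] at hi
  rw [hf' _ _ (by omega), smul_zero]

theorem neg_one_zpow_smul_fst {N : ℕ} {d : ℤ} {x : B × B} (hx : x ∈ grA k B N d) :
    ((-1 : k) ^ d) • x.1 = -x.1 := by
  rcases (mem_grA_iff.1 hx).1 with h | h
  · rw [h]; simp
  · simp [h]

theorem neg_one_zpow_smul_snd {N : ℕ} {d : ℤ} {x : B × B} (hx : x ∈ grA k B N d) :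
    ((-1 : k) ^ d) • x.2 = -(((-1 : ℤ) ^ N) • x.2) := by
  rcases (mem_grA_iff.1 hx).2 with h | h
  · rw [h]
    rcases Nat.even_or_odd N with hN | hN
    · have : Odd (1 - (N : ℤ)) := by
        obtain ⟨r, rfl⟩ := hN; exact ⟨-r, by push_cast; ring⟩
      simp [this.neg_one_zpow, hN.neg_one_pow]
    · have : Even (1 - (N : ℤ)) := by
        obtain ⟨r, rfl⟩ := hN; exact ⟨-r, by push_cast; ring⟩
      simp [this.neg_one_zpow, hN.neg_one_pow]
  · simp [h]

theorem compSum_mulOp_mulOp {N n : ℕ} {p : Fin n → ℤ} {v : Fin n → B × B}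
    (hv : ∀ t, v t ∈ grA k B N (p t)) : compSum k (mulOp N) (mulOp N) n p v = 0 := by
  by_cases hn : n = 3
  · subst hn
    rw [compSum_eq_of_arity (isMultilinear_mulOp N) one_le_two fun j v h => mulOp_of_ne h v]
    have h₁ := neg_one_zpow_smul_fst (hv 0)
    have h₂ := neg_one_zpow_smul_snd (hv 0)
    have hs : (-1 : ℤ) ^ N * (-1) ^ N = 1 := by rw [← mul_pow]; simp
    simp only [Nat.reduceAdd, Nat.reduceSub, Finset.sum_range_succ, Finset.sum_range_zero, mulOp]
    generalize (-1 : ℤ) ^ N = s at *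
    simp [insArg, shiftArg, partialDeg, -zsmul_eq_mul]
    simp only [← smul_mul_assoc, smul_comm ((-1 : k) ^ p 0) s, h₁, h₂]
    constructor
    · noncomm_ring
    · simp only [mul_add, add_mul, neg_mul, smul_mul_assoc, mul_smul_comm, smul_neg, smul_smul, hs,
        smul_add, mul_assoc, one_smul]
      abel
  · exact compSum_eq_zero_of_arity (isMultilinear_mulOp N) one_le_two
      (fun j v h => mulOp_of_ne h v) (fun j v h => mulOp_of_ne h v) (by omega) p v

/-- The entries of the `i`-th inner summand of the Hochschild differential. -/
def face {N : ℕ} (a : Fin (N + 1) → B) (i : Fin N) : Fin N → B := fun t =>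
  if (t : ℕ) < (i : ℕ) then a t.castSucc
  else if (t : ℕ) = (i : ℕ) then a i.castSucc * a i.succ
  else a t.succ

theorem exists_face_eq_zero {N : ℕ} {a : Fin (N + 1) → B} {s : Fin (N + 1)} (hs : a s = 0)
    (i : Fin N) : ∃ t, face a i t = 0 := by
  rcases lt_trichotomy s i.castSucc with h | h | h
  · have h' : (s : ℕ) < i := h
    exact ⟨⟨s, by omega⟩, by simp [face, h', hs]⟩
  · subst h
    exact ⟨i, by simp [face, hs]⟩
  · have h' : (i : ℕ) < s := h
    by_cases h'' : (s : ℕ) = i + 1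
    · have : s = i.succ := Fin.ext h''
      subst this
      exact ⟨i, by simp [face, hs]⟩
    · refine ⟨⟨s - 1, by omega⟩, ?_⟩
      have h₁ : ¬ (s : ℕ) - 1 < i := by omega
      have h₂ : ¬ (s : ℕ) - 1 = i := by omega
      have h₃ : (⟨s - 1, by omega⟩ : Fin N).succ = s := by ext; simp; omega
      simp [face, h₁, h₂, h₃, hs]

theorem compSum_mulOp_epsOp {N : ℕ} (hN : 1 ≤ N) (c : (Fin N → B) → B)
    (p : Fin (N + 1) → ℤ) (v : Fin (N + 1) → B × B) :
    compSum k (mulOp N) (epsOp N c) (N + 1) p v =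
      (0, ((-1 : ℤ) ^ N) • (c (fun t => (v t.castSucc).1) * (v (Fin.last N)).1) +
        ((-1 : k) ^ p 0) • ((v 0).1 * c (fun t => (v t.succ).1))) := by
  rw [compSum_eq_of_arity (isMultilinear_mulOp N) hN fun j v h => epsOp_of_ne c h v]
  have h : N + 1 + 1 - N = 2 := by omega
  have e₀ : (fun t : Fin N => (shiftArg (N + 1) 0 N v t).1) = fun t => (v t.castSucc).1 := by
    funext t
    have : (t : ℕ) < N + 1 := by omega
    simp [shiftArg, this]; rfl
  have e₁ : (fun t : Fin N => (shiftArg (N + 1) 1 N v t).1) = fun t => (v t.succ).1 := by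
    funext t
    have : 1 + (t : ℕ) < N + 1 := by omega
    simp [shiftArg, this]
    congr 2; ext; simp; omega
  simp only [h, Finset.sum_range_succ, Finset.sum_range_zero]
  simp [mulOp, insArg, epsOp, partialDeg, e₀, e₁]
  rfl

theorem compSum_epsOp_mulOp {N : ℕ} {c : (Fin N → B) → B} (hc : IsMultilinear k c)
    (p : Fin (N + 1) → ℤ) (v : Fin (N + 1) → B × B) :
    compSum k (epsOp N c) (mulOp N) (N + 1) p v =
      (0, ∑ i : Fin N, ((-1 : k) ^ partialDeg (N + 1) i p) •
        c (face (fun t => (v t).1) i)) := by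
  rw [compSum_eq_of_arity (isMultilinear_epsOp hc) one_le_two fun j v h => mulOp_of_ne h v]
  have h : N + 1 + 1 - 2 = N := by omega
  rw [h, Finset.sum_range]
  have key : ∀ i : Fin N, epsOp N c (i + 1 + (N + 1 - i - 2))
      (insArg (N + 1) i 2 v (mulOp N 2 (shiftArg (N + 1) i 2 v))) =
        (0, c (face (fun t => (v t).1) i)) := by
    intro i
    have hi : (i : ℕ) + 1 + (N + 1 - i - 2) = N := by omega
    rw [epsOp, dif_pos hi]
    congr 2
    funext t
    have ht : (t : ℕ) < N + 1 := by omega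
    have hi₀ : (i : ℕ) < N + 1 := by omega
    simp only [insArg, face, Fin.val_cast, ht, and_true]
    split_ifs with h₁ h₂ h₃
    · rfl
    · simp [mulOp, shiftArg, hi₀]; rfl
    · rfl
    · omega
  simp only [key]
  ext
  · simp [Prod.fst_sum]
  · simp [Prod.snd_sum]

theorem partialDeg_neg_one {n i : ℕ} (hi : i ≤ n) : partialDeg n i (fun _ => -1) = -(i : ℤ) := by
  unfold partialDeg
  rw [Finset.sum_congr rfl fun t ht => dif_pos (by rw [Finset.mem_range] at ht; omega)]
  simp

/-- The Hochschild differential of `c`. -/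
def hochschildDiff {N : ℕ} (c : (Fin N → B) → B) (a : Fin (N + 1) → B) : B :=
  a 0 * c (fun t => a t.succ)
    + (∑ i : Fin N, ((-1 : ℤ) ^ ((i : ℕ) + 1)) • c (face a i))
    + ((-1 : ℤ) ^ (N + 1)) • (c (fun t => a t.castSucc) * a (Fin.last N))

theorem isHochschildCocycle_iff {N : ℕ} {c : (Fin N → B) → B} :
    IsHochschildCocycle B N c ↔ ∀ a, hochschildDiff c a = 0 := Iff.rfl

theorem neg_one_zpow_neg_smul (i : ℕ) (x : B) :
    ((-1 : k) ^ (-(i : ℤ))) • x = -(((-1 : ℤ) ^ (i + 1)) • x) := by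
  rw [zpow_neg, zpow_natCast, ← inv_pow, inv_neg, inv_one]
  rcases Nat.even_or_odd i with h | h <;> simp [pow_succ, h.neg_one_pow]

theorem compSum_bOp_neg_one {N : ℕ} (hN : 1 ≤ N) {c : (Fin N → B) → B}
    (hc : IsMultilinear k c) {v : Fin (N + 1) → B × B} (hv : ∀ t, v t ∈ grA k B N (-1)) :
    compSum k (bOp B N c) (bOp B N c) (N + 1) (fun _ => -1) v =
      (0, -hochschildDiff c fun t => (v t).1) := by
  rw [compSum_bOp hc, compSum_mulOp_mulOp hv, zero_add, compSum_mulOp_epsOp hN c,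
    compSum_epsOp_mulOp hc, Prod.mk_add_mk, add_zero]
  congr 1
  have h : ∀ i : Fin N, ((-1 : k) ^ partialDeg (N + 1) i fun _ => -1) •
      c (face (fun t => (v t).1) i) =
        -(((-1 : ℤ) ^ ((i : ℕ) + 1)) • c (face (fun t => (v t).1) i)) := by
    intro i
    rw [partialDeg_neg_one (by omega), neg_one_zpow_neg_smul]
  rw [Finset.sum_congr rfl fun i _ => h i, Finset.sum_neg_distrib, hochschildDiff]
  simp only [pow_succ (-1 : ℤ) N, mul_neg_one, neg_smul, zpow_neg_one, inv_neg, inv_one, one_smul]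
  abel

theorem compSum_bOp_eq_zero_of_ne {N : ℕ} (hN : 1 ≤ N) {c : (Fin N → B) → B}
    (hc : IsMultilinear k c) {p : Fin (N + 1) → ℤ} {v : Fin (N + 1) → B × B}
    (hv : ∀ t, v t ∈ grA k B N (p t)) {s : Fin (N + 1)} (hs : p s ≠ -1) :
    compSum k (bOp B N c) (bOp B N c) (N + 1) p v = 0 := by
  have h₀ : (v s).1 = 0 := (mem_grA_iff.1 (hv s)).1.resolve_left hs
  rw [compSum_bOp hc, compSum_mulOp_mulOp hv, zero_add, compSum_mulOp_epsOp hN c,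
    compSum_epsOp_mulOp hc]
  have h₁ : ∀ i : Fin N, c (face (fun t => (v t).1) i) = 0 := fun i => by
    obtain ⟨t, ht⟩ := exists_face_eq_zero (a := fun t => (v t).1) h₀ i
    exact hc.eq_zero_of_apply_eq_zero t ht
  have h₂ : c (fun t => (v t.castSucc).1) * (v (Fin.last N)).1 = 0 := by
    induction s using Fin.lastCases with
    | last => rw [h₀, mul_zero]
    | cast t => rw [hc.eq_zero_of_apply_eq_zero t h₀, zero_mul]
  have h₃ : (v 0).1 * c (fun t => (v t.succ).1) = 0 := by
    induction s using Fin.cases with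
    | zero => rw [h₀, zero_mul]
    | succ t => rw [hc.eq_zero_of_apply_eq_zero t h₀, mul_zero]
  simp [h₁, h₂, h₃]

end Deformation

/-- `A = B[ε]/(ε²)`, with `ε` in degree `2 - N` and the operations `b'`,
is an A∞-algebra if and only if `c` is a Hochschild `N`-cocycle for `B`. -/
theorem deformation_aInfinity_iff_hochschild_cocycle
    (N : ℕ) (hN : 1 ≤ N) (c : (Fin N → B) → B) (hc : IsMultilinear k c) :
    IsAInfinity k (B × B) (grA k B N) (bOp B N c) ↔ IsHochschildCocycle B N c := by
  rw [isHochschildCocycle_iff]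
  constructor
  · rintro ⟨-, -, -, h⟩ a
    have hv : ∀ t, (a t, (0 : B)) ∈ grA k B N (-1) := fun t => mem_grA_iff.2 (by simp)
    have h' := (compSum_bOp_neg_one hN hc hv).symm.trans (h (N + 1) (by omega) _ _ hv)
    exact neg_eq_zero.1 (congrArg Prod.snd h')
  · intro h
    refine ⟨?_, isMultilinear_bOp hc, fun n p v hv => ?_, fun n _ p v hv => ?_⟩
    · funext v
      rw [bOp_eq, mulOp_of_ne (by omega), epsOp_of_ne c (by omega), add_zero]
      rfl
    · exact add_mem (mulOp_mem_grA hv) (epsOp_mem_grA hc hv)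
    · change compSum k (bOp B N c) (bOp B N c) n p v = 0
      by_cases hn : n = N + 1
      · subst hn
        by_cases hp : ∀ t, p t = -1
        · obtain rfl : p = fun _ => -1 := funext hp
          rw [compSum_bOp_neg_one hN hc hv, h, neg_zero]
          rfl
        · push Not at hp
          obtain ⟨s, hs⟩ := hp
          exact compSum_bOp_eq_zero_of_ne hN hc hv hs
      · rw [compSum_bOp hc, compSum_mulOp_mulOp hv,
          compSum_eq_zero_of_arity (isMultilinear_mulOp N) hN (fun j v h => epsOp_of_ne c h v)
            (fun j v h => mulOp_of_ne h v) (by omega),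
          compSum_eq_zero_of_arity (isMultilinear_epsOp hc) one_le_two
            (fun j v h => mulOp_of_ne h v) (fun j v h => epsOp_of_ne c h v) (by omega),
          add_zero, add_zero]

end Stmt0
end

section
/- Let k be a field, A an A∞-algebra, V a complex of k-vector spaces, and f_1 : A → V a quasi-isomorphism of complexes (where A carries the differential m_1 = −b_1). Then V admits a structure of A∞-algebra whose operation b_1 is (the suspension of) the given differential of V, such that f_1 extends to an A∞-quasi-isomorphism f : A → V with first component f_1. -/
/-!
# Statement 12

Let `k` be a field, `A` an A∞-algebra, `V` a complex of `k`-vector spaces and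
`f₁ : A → V` a quasi-isomorphism of complexes (`A` carries the differential
`m₁ = -b₁`).  Then `V` admits an A∞-algebra structure whose `b₁` is (the suspension
of) the given differential of `V` (i.e. `b₁ = -d_V`), such that `f₁` extends to an
A∞-quasi-isomorphism `f : A → V` with first component `f₁`.

Conventions: the carrier of an A∞-structure is the suspension; its degree-`p` part
corresponds to the degree-`(p+1)` part of the underlying complex.  Thus the A∞-structure
produced on `V` lives on the grading `p ↦ grV (p+1)`, and `f₁` (a map of complexes,
homogeneous of degree `0` for the unsuspended gradings) sends `A.gr p` to `grV (p+1)`.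
-/

open Finset Function

namespace Stmt12

variable (k : Type) [Field k]

/-- An `n`-ary operation is `k`-multilinear. -/
def IsMultilinear {M N : Type} [AddCommGroup M] [Module k M] [AddCommGroup N] [Module k N]
    {n : ℕ} (f : (Fin n → M) → N) : Prop :=
  (∀ (v : Fin n → M) (i : Fin n) (x y : M),
      f (Function.update v i (x + y)) = f (Function.update v i x) + f (Function.update v i y)) ∧
  (∀ (v : Fin n → M) (i : Fin n) (a : k) (x : M),
      f (Function.update v i (a • x)) = a • f (Function.update v i x))

/-- The tuple obtained from `v` by replacing the `j` entries `v_{i+1}, …, v_{i+j}`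
by the single entry `x`. -/
def insArg {M : Type} [Zero M] (n i j : ℕ) (v : Fin n → M) (x : M) :
    Fin (i + 1 + (n - i - j)) → M := fun t =>
  if h : (t : ℕ) < i ∧ (t : ℕ) < n then v ⟨t, h.2⟩
  else if (t : ℕ) = i then x
  else if h2 : (t : ℕ) + j - 1 < n then v ⟨(t : ℕ) + j - 1, h2⟩ else 0

/-- The tuple `(v_{i+1}, …, v_{i+j})`. -/
def shiftArg {M : Type} [Zero M] (n i j : ℕ) (v : Fin n → M) : Fin j → M := fun t =>
  if h : i + (t : ℕ) < n then v ⟨i + t, h⟩ else 0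

/-- The Koszul sign exponent `p_1 + ⋯ + p_i`. -/
def partialDeg (n i : ℕ) (p : Fin n → ℤ) : ℤ :=
  ∑ t ∈ Finset.range i, if h : t < n then p ⟨t, h⟩ else 0

/-- `b` is an A∞-algebra structure on the graded space `(M, gr)` (`gr` being the grading of
the suspension `SA`): multilinear operations of degree `1`, defined for `n ≥ 1`, satisfying
the A∞-relations `∑_{i+j+l=n} b_{i+1+l} ∘ (1^{⊗i} ⊗ b_j ⊗ 1^{⊗l}) = 0` with Koszul signs. -/
def IsAInfinity (M : Type) [AddCommGroup M] [Module k M] (gr : ℤ → Submodule k M)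
    (b : ∀ n : ℕ, (Fin n → M) → M) : Prop :=
  b 0 = 0 ∧
  (∀ n, IsMultilinear k (b n)) ∧
  (∀ (n : ℕ) (p : Fin n → ℤ) (v : Fin n → M),
      (∀ t, v t ∈ gr (p t)) → b n v ∈ gr (1 + ∑ t, p t)) ∧
  (∀ (n : ℕ), 1 ≤ n → ∀ (p : Fin n → ℤ) (v : Fin n → M), (∀ t, v t ∈ gr (p t)) →
      ∑ i ∈ Finset.range n, ∑ j ∈ Finset.Icc 1 (n - i),
        ((-1 : k) ^ partialDeg n i p) •
          b (i + 1 + (n - i - j)) (insArg n i j v (b j (shiftArg n i j v))) = 0)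

/-- `f` is a morphism of A∞-algebras from `(M, gr, b)` to `(M', gr', b')`:
a family of multilinear maps `f_n`, `n ≥ 1`, homogeneous of degree `0`, with
`∑_{i+j+l=n} f_{i+1+l} ∘ (1^{⊗i} ⊗ b_j ⊗ 1^{⊗l}) = ∑_{i_1+⋯+i_s=n} b'_s ∘ (f_{i_1} ⊗ ⋯ ⊗ f_{i_s})`
(Koszul signs; the right-hand sum is over all compositions of `n`). -/
def IsAInfMorphism (M : Type) [AddCommGroup M] [Module k M] (gr : ℤ → Submodule k M)
    (b : ∀ n : ℕ, (Fin n → M) → M)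
    (M' : Type) [AddCommGroup M'] [Module k M'] (gr' : ℤ → Submodule k M')
    (b' : ∀ n : ℕ, (Fin n → M') → M')
    (f : ∀ n : ℕ, (Fin n → M) → M') : Prop :=
  f 0 = 0 ∧
  (∀ n, IsMultilinear k (f n)) ∧
  (∀ (n : ℕ) (p : Fin n → ℤ) (v : Fin n → M),
      (∀ t, v t ∈ gr (p t)) → f n v ∈ gr' (∑ t, p t)) ∧
  (∀ (n : ℕ), 1 ≤ n → ∀ (p : Fin n → ℤ) (v : Fin n → M), (∀ t, v t ∈ gr (p t)) →
      ∑ i ∈ Finset.range n, ∑ j ∈ Finset.Icc 1 (n - i),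
        ((-1 : k) ^ partialDeg n i p) •
          f (i + 1 + (n - i - j)) (insArg n i j v (b j (shiftArg n i j v)))
      = ∑ comp : Composition n,
          b' comp.length (fun s => f (comp.blocksFun s) (fun t => v (comp.embedding s t))))

/-- A bundled A∞-algebra over `k` (the grading, which is an internal direct-sum
decomposition, is that of the suspension `SA`). -/
structure AInfAlg where
  M : Type
  [acg : AddCommGroup M]
  [mod : Module k M]
  gr : ℤ → Submodule k M
  internal : DirectSum.IsInternal gr
  b : ∀ n : ℕ, (Fin n → M) → M
  isAInf : IsAInfinity k M gr b

attribute [instance] AInfAlg.acg AInfAlg.mod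

section TensorCoalgebra

open TensorAlgebra TensorProduct Coalgebra

variable {k}
variable {M : Type} [AddCommGroup M] [Module k M]

/-- The word `x₁ ⊗ ⋯ ⊗ xₙ` in the tensor algebra. -/
def word (l : List M) : TensorAlgebra k M := (l.map (ι k)).prod

@[simp] theorem word_nil : word (k := k) ([] : List M) = 1 := by simp [word]

@[simp] theorem word_cons (x : M) (l : List M) : word (k := k) (x :: l) = ι k x * word l := by
  simp [word]

theorem word_append (l l' : List M) : word (k := k) (l ++ l') = word l * word l' := by
  simp [word]

theorem tprod_eq_word {n : ℕ} (v : Fin n → M) : tprod k M n v = word (List.ofFn v) := by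
  simp [word, tprod_apply, List.map_ofFn, Function.comp_def]

theorem span_range_word : Submodule.span k (Set.range (word (k := k) (M := M))) = ⊤ := by
  set S := Submodule.span k (Set.range (word (k := k) (M := M)))
  have key : ∀ t : TensorAlgebra k M, ∀ s ∈ S, t * s ∈ S := by
    intro t
    induction t using TensorAlgebra.induction with
    | algebraMap r =>
      intro s hs
      rw [← Algebra.smul_def]
      exact S.smul_mem r hs
    | ι x =>
      intro s hs
      induction hs using Submodule.span_induction with
      | mem s hs =>
        obtain ⟨l, rfl⟩ := hs
        exact Submodule.subset_span ⟨x :: l, word_cons x l⟩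
      | zero => simp
      | add a b _ _ ha hb => rw [mul_add]; exact S.add_mem ha hb
      | smul r a _ ha => rw [mul_smul_comm]; exact S.smul_mem r ha
    | mul a b ha hb =>
      intro s hs
      rw [mul_assoc]
      exact ha _ (hb s hs)
    | add a b ha hb =>
      intro s hs
      rw [add_mul]
      exact S.add_mem (ha s hs) (hb s hs)
  rw [eq_top_iff]
  intro t _
  simpa using key t 1 (Submodule.subset_span ⟨[], word_nil⟩)

theorem ext_word {N : Type} [AddCommGroup N] [Module k N] {f g : TensorAlgebra k M →ₗ[k] N}
    (h : ∀ l : List M, f (word l) = g (word l)) : f = g := by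
  refine LinearMap.ext_on span_range_word ?_
  rintro _ ⟨l, rfl⟩
  exact h l

/-- Left multiplication by a letter on pairs `(t, Δ t)`. -/
noncomputable def comulStep : M →ₗ[k]
    Module.End k (TensorAlgebra k M × (TensorAlgebra k M ⊗[k] TensorAlgebra k M)) where
  toFun x :=
    { toFun := fun p => (ι k x * p.1, 1 ⊗ₜ (ι k x * p.1) + (ι k x ⊗ₜ 1) * p.2)
      map_add' := fun p q => by
        ext1
        · simp [mul_add]
        · simp only [Prod.fst_add, Prod.snd_add, mul_add, tmul_add]; abel
      map_smul' := fun r p => by ext1 <;> simp }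
  map_add' x y := by
    refine LinearMap.ext fun p => Prod.ext ?_ ?_
    · simp [add_mul]
    · simp only [LinearMap.coe_mk, AddHom.coe_mk, map_add, add_mul, tmul_add, add_tmul,
        LinearMap.add_apply, Prod.snd_add]
      abel
  map_smul' r x := by
    refine LinearMap.ext fun p => Prod.ext ?_ ?_
    · simp
    · simp only [LinearMap.coe_mk, AddHom.coe_mk, map_smul, LinearMap.smul_apply, Prod.smul_snd,
        smul_mul_assoc, tmul_smul, smul_add, ← smul_tmul', RingHom.id_apply]

theorem comulStep_apply (x : M)
    (p : TensorAlgebra k M × (TensorAlgebra k M ⊗[k] TensorAlgebra k M)) :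
    comulStep x p = (ι k x * p.1, 1 ⊗ₜ (ι k x * p.1) + (ι k x ⊗ₜ 1) * p.2) := rfl

/-- The deconcatenation coproduct. -/
noncomputable def deconcat :
    TensorAlgebra k M →ₗ[k] TensorAlgebra k M ⊗[k] TensorAlgebra k M :=
  LinearMap.snd k _ _ ∘ₗ (LinearMap.applyₗ (1, 1 ⊗ₜ[k] 1)) ∘ₗ
    (TensorAlgebra.lift k (comulStep (k := k) (M := M))).toLinearMap

theorem lift_comulStep_fst (l : List M) :
    (TensorAlgebra.lift k (comulStep (k := k) (M := M)) (word l) (1, 1 ⊗ₜ[k] 1)).1 = word l := by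
  induction l with
  | nil => simp
  | cons x l ih =>
    rw [word_cons, map_mul, TensorAlgebra.lift_ι_apply, Module.End.mul_apply,
      comulStep_apply, ih]

theorem deconcat_one : deconcat (1 : TensorAlgebra k M) = 1 ⊗ₜ 1 := by
  simp [deconcat]

theorem deconcat_ι_mul (x : M) (t : TensorAlgebra k M) :
    deconcat (ι k x * t) = 1 ⊗ₜ (ι k x * t) + (ι k x ⊗ₜ 1) * deconcat t := by
  have h : deconcat ∘ₗ LinearMap.mulLeft k (ι k x) =
      TensorProduct.mk k _ _ 1 ∘ₗ LinearMap.mulLeft k (ι k x) +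
        LinearMap.mulLeft k (ι k x ⊗ₜ 1) ∘ₗ deconcat := by
    refine ext_word fun l => ?_
    have h1 := lift_comulStep_fst (k := k) l
    simp only [LinearMap.comp_apply, LinearMap.mulLeft_apply, LinearMap.add_apply, deconcat,
      AlgHom.toLinearMap_apply, map_mul, LinearMap.applyₗ_apply_apply, TensorAlgebra.lift_ι_apply,
      Module.End.mul_apply, comulStep_apply, h1, LinearMap.snd_apply, TensorProduct.mk_apply]
  exact LinearMap.congr_fun h t

theorem deconcat_ι (x : M) : deconcat (ι k x) = 1 ⊗ₜ ι k x + ι k x ⊗ₜ 1 := by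
  simpa [deconcat_one] using deconcat_ι_mul (k := k) x 1

theorem deconcat_mul (s t : TensorAlgebra k M) :
    deconcat (s * t) = deconcat s * (1 ⊗ₜ t) + (s ⊗ₜ 1) * deconcat t - s ⊗ₜ t := by
  have h : deconcat ∘ₗ LinearMap.mulRight k t =
      LinearMap.mulRight k (1 ⊗ₜ t) ∘ₗ deconcat +
        LinearMap.mulRight k (deconcat t) ∘ₗ (TensorProduct.mk k _ _).flip 1
        - (TensorProduct.mk k _ _).flip t := by
    refine ext_word fun l => ?_
    induction l with
    | nil => simp [deconcat_one, ← Algebra.TensorProduct.one_def]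
    | cons x l ih =>
      simp only [LinearMap.comp_apply, LinearMap.mulRight_apply, LinearMap.add_apply,
        LinearMap.sub_apply, LinearMap.flip_apply, TensorProduct.mk_apply] at ih
      simp only [LinearMap.comp_apply, LinearMap.mulRight_apply, LinearMap.add_apply,
        LinearMap.sub_apply, LinearMap.flip_apply, TensorProduct.mk_apply, word_cons, mul_assoc,
        deconcat_ι_mul, ih]
      simp only [mul_add, mul_sub, add_mul, ← mul_assoc, Algebra.TensorProduct.tmul_mul_tmul,
        mul_one, one_mul]
      abel
  exact LinearMap.congr_fun h s

noncomputable instance : Coalgebra k (TensorAlgebra k M) where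
  comul := deconcat
  counit := TensorAlgebra.algebraMapInv.toLinearMap
  coassoc := by
    have aux : ∀ (x : M) (s : TensorAlgebra k M ⊗[k] TensorAlgebra k M),
        TensorProduct.assoc k _ _ _ (LinearMap.rTensor _ deconcat ((ι k x ⊗ₜ 1) * s)) =
          1 ⊗ₜ ((ι k x ⊗ₜ 1) * s) +
            (ι k x ⊗ₜ 1) * TensorProduct.assoc k _ _ _ (LinearMap.rTensor _ deconcat s) := by
      intro x s
      induction s using TensorProduct.induction_on with
      | zero => simp
      | add a b ha hb => simp only [mul_add, map_add, ha, hb, tmul_add]; abel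
      | tmul a b =>
        simp only [Algebra.TensorProduct.tmul_mul_tmul, one_mul, LinearMap.rTensor_tmul,
          deconcat_ι_mul, add_tmul, map_add, TensorProduct.assoc_tmul]
        congr 1
        generalize deconcat a = c
        induction c using TensorProduct.induction_on with
        | zero => simp
        | add a b ha hb => simp only [mul_add, map_add, ha, hb, add_tmul]
        | tmul a b => simp
    have aux' : ∀ (x : M) (s : TensorAlgebra k M ⊗[k] TensorAlgebra k M),
        LinearMap.lTensor _ deconcat ((ι k x ⊗ₜ 1) * s) =
            (ι k x ⊗ₜ 1) * LinearMap.lTensor _ deconcat s := by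
      intro x s
      induction s using TensorProduct.induction_on with
      | zero => simp
      | add a b ha hb => simp only [mul_add, map_add, ha, hb]
      | tmul a b => simp
    refine ext_word fun l => ?_
    induction l with
    | nil => simp [deconcat_one]
    | cons x l ih =>
      simp only [LinearMap.comp_apply, LinearEquiv.coe_coe] at ih ⊢
      rw [word_cons, deconcat_ι_mul, map_add, map_add, map_add, aux, aux', ih]
      simp only [LinearMap.rTensor_tmul, LinearMap.lTensor_tmul, deconcat_one,
        TensorProduct.assoc_tmul, deconcat_ι_mul, tmul_add]
      abel
  rTensor_counit_comp_comul := by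
    have aux : ∀ (x : M) (s : TensorAlgebra k M ⊗[k] TensorAlgebra k M),
        LinearMap.rTensor _ (TensorAlgebra.algebraMapInv (R := k)).toLinearMap
          ((ι k x ⊗ₜ 1) * s) = 0 := by
      intro x s
      induction s using TensorProduct.induction_on with
      | zero => simp
      | add a b ha hb => rw [mul_add, map_add, ha, hb, add_zero]
      | tmul a b => simp [TensorAlgebra.algebraMapInv]
    refine ext_word fun l => ?_
    cases l with
    | nil => simp [deconcat_one]
    | cons x l => simp [deconcat_ι_mul, aux]
  lTensor_counit_comp_comul := by
    have aux : ∀ (x : M) (s : TensorAlgebra k M ⊗[k] TensorAlgebra k M),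
        LinearMap.lTensor _ (TensorAlgebra.algebraMapInv (R := k)).toLinearMap
          ((ι k x ⊗ₜ 1) * s) = (ι k x ⊗ₜ 1) *
            LinearMap.lTensor _ (TensorAlgebra.algebraMapInv (R := k)).toLinearMap s := by
      intro x s
      induction s using TensorProduct.induction_on with
      | zero => simp
      | add a b ha hb => simp only [mul_add, map_add, ha, hb]
      | tmul a b => simp
    refine ext_word fun l => ?_
    induction l with
    | nil => simp [deconcat_one]
    | cons x l ih =>
      simp only [LinearMap.comp_apply] at ih
      simp only [LinearMap.comp_apply, word_cons, deconcat_ι_mul, map_add, aux, ih]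
      simp [TensorAlgebra.algebraMapInv]

end TensorCoalgebra

section Convolution

open TensorAlgebra TensorProduct Coalgebra WithConv

variable {k}
variable {M : Type} [AddCommGroup M] [Module k M]
variable {N : Type} [AddCommGroup N] [Module k N]
variable {P : Type} [AddCommGroup P] [Module k P]
variable {R : Type} [Ring R] [Algebra k R] {R' : Type} [Ring R'] [Algebra k R']

/-- Convolution of linear maps from a tensor coalgebra to an algebra. -/
noncomputable def conv (X Y : TensorAlgebra k M →ₗ[k] R) : TensorAlgebra k M →ₗ[k] R :=
  (toConv X * toConv Y).ofConv

/-- The unit of the convolution product. -/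
noncomputable def convUnit (k M R : Type) [Field k] [AddCommGroup M] [Module k M] [Ring R]
    [Algebra k R] : TensorAlgebra k M →ₗ[k] R :=
  (1 : WithConv (TensorAlgebra k M →ₗ[k] R)).ofConv

local infixr:72 "⋆" => conv

theorem conv_assoc (X Y Z : TensorAlgebra k M →ₗ[k] R) : (X ⋆ Y) ⋆ Z = X ⋆ Y ⋆ Z :=
  congrArg ofConv (mul_assoc (toConv X) (toConv Y) (toConv Z))

theorem conv_add (X Y Z : TensorAlgebra k M →ₗ[k] R) : X ⋆ (Y + Z) = X ⋆ Y + X ⋆ Z :=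
  congrArg ofConv (mul_add (toConv X) (toConv Y) (toConv Z))

theorem add_conv (X Y Z : TensorAlgebra k M →ₗ[k] R) : (X + Y) ⋆ Z = X ⋆ Z + Y ⋆ Z :=
  congrArg ofConv (add_mul (toConv X) (toConv Y) (toConv Z))

theorem conv_sub (X Y Z : TensorAlgebra k M →ₗ[k] R) : X ⋆ (Y - Z) = X ⋆ Y - X ⋆ Z :=
  congrArg ofConv (mul_sub (toConv X) (toConv Y) (toConv Z))

theorem sub_conv (X Y Z : TensorAlgebra k M →ₗ[k] R) : (X - Y) ⋆ Z = X ⋆ Z - Y ⋆ Z :=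
  congrArg ofConv (sub_mul (toConv X) (toConv Y) (toConv Z))

theorem conv_neg (X Y : TensorAlgebra k M →ₗ[k] R) : X ⋆ (-Y) = -(X ⋆ Y) :=
  congrArg ofConv (mul_neg (toConv X) (toConv Y))

theorem neg_conv (X Y : TensorAlgebra k M →ₗ[k] R) : (-X) ⋆ Y = -(X ⋆ Y) :=
  congrArg ofConv (neg_mul (toConv X) (toConv Y))

theorem conv_zero (X : TensorAlgebra k M →ₗ[k] R) : X ⋆ 0 = 0 :=
  congrArg ofConv (mul_zero (toConv X))

theorem zero_conv (X : TensorAlgebra k M →ₗ[k] R) : 0 ⋆ X = 0 :=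
  congrArg ofConv (zero_mul (toConv X))

theorem convUnit_conv (X : TensorAlgebra k M →ₗ[k] R) : convUnit k M R ⋆ X = X :=
  congrArg ofConv (one_mul (toConv X))

theorem conv_convUnit (X : TensorAlgebra k M →ₗ[k] R) : X ⋆ convUnit k M R = X :=
  congrArg ofConv (mul_one (toConv X))

theorem conv_eq (X Y : TensorAlgebra k M →ₗ[k] R) :
    X ⋆ Y = LinearMap.mul' k R ∘ₗ TensorProduct.map X Y ∘ₗ comul := rfl

theorem conv_apply (X Y : TensorAlgebra k M →ₗ[k] R) (t : TensorAlgebra k M) :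
    (X ⋆ Y) t = LinearMap.mul' k R (TensorProduct.map X Y (comul t)) := rfl

theorem convUnit_eq :
    convUnit k M R = Algebra.linearMap k R ∘ₗ (counit : TensorAlgebra k M →ₗ[k] k) := rfl

theorem counit_one : counit (R := k) (1 : TensorAlgebra k M) = 1 :=
  map_one TensorAlgebra.algebraMapInv

theorem counit_mul (s t : TensorAlgebra k M) :
    counit (R := k) (s * t) = counit (R := k) s * counit (R := k) t :=
  map_mul TensorAlgebra.algebraMapInv s t

theorem counit_ι (x : M) : counit (R := k) (ι k x) = 0 := by
  change TensorAlgebra.algebraMapInv (ι k x) = 0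
  simp [TensorAlgebra.algebraMapInv]

theorem comul_one : comul (R := k) (1 : TensorAlgebra k M) = 1 ⊗ₜ 1 := deconcat_one

theorem comul_ι_mul (x : M) (t : TensorAlgebra k M) :
    comul (R := k) (ι k x * t) = 1 ⊗ₜ (ι k x * t) + (ι k x ⊗ₜ 1) * comul (R := k) t :=
  deconcat_ι_mul x t

theorem comul_mul (s t : TensorAlgebra k M) :
    comul (R := k) (s * t) =
      comul (R := k) s * (1 ⊗ₜ t) + (s ⊗ₜ 1) * comul (R := k) t - s ⊗ₜ t :=
  deconcat_mul s t

theorem comul_ι (x : M) : comul (R := k) (ι k x) = 1 ⊗ₜ ι k x + ι k x ⊗ₜ 1 := deconcat_ι x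

theorem comul_word (l : List M) :
    comul (R := k) (word (k := k) l) =
      ∑ i ∈ Finset.range (l.length + 1), word (l.take i) ⊗ₜ word (l.drop i) := by
  induction l with
  | nil => simp [comul_one]
  | cons x l ih =>
    rw [word_cons, comul_ι_mul, ih, List.length_cons, Finset.sum_range_succ' _ (l.length + 1),
      Finset.mul_sum, add_comm]
    simp

theorem convUnit_one : convUnit k M R 1 = 1 := by
  simp [convUnit_eq, counit_one]

theorem convUnit_word_cons (x : M) (l : List M) : convUnit k M R (word (x :: l)) = 0 := by
  simp [convUnit_eq, counit_mul, counit_ι]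

theorem conv_word (X Y : TensorAlgebra k M →ₗ[k] R) (l : List M) :
    (X ⋆ Y) (word l) =
      ∑ i ∈ Finset.range (l.length + 1), X (word (l.take i)) * Y (word (l.drop i)) := by
  simp [conv_apply, comul_word]

theorem conv_one_apply (X Y : TensorAlgebra k M →ₗ[k] R) : (X ⋆ Y) 1 = X 1 * Y 1 := by
  simp [conv_apply, comul_one]

theorem algHom_comp_conv (F : R →ₐ[k] R') (X Y : TensorAlgebra k M →ₗ[k] R) :
    F.toLinearMap ∘ₗ (X ⋆ Y) = (F.toLinearMap ∘ₗ X) ⋆ (F.toLinearMap ∘ₗ Y) :=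
  LinearMap.algHom_comp_convMul_distrib F (toConv X) (toConv Y)

theorem algHom_comp_convUnit (F : R →ₐ[k] R') :
    F.toLinearMap ∘ₗ convUnit k M R = convUnit k M R' := by
  ext t; simp [convUnit_eq]

/-- `P` preserves the deconcatenation coproduct and the counit. -/
def IsCoalgMap (F : TensorAlgebra k M →ₗ[k] TensorAlgebra k N) : Prop :=
  comul ∘ₗ F = TensorProduct.map F F ∘ₗ comul ∧ counit ∘ₗ F = (counit : _ →ₗ[k] k)

/-- `Z` is an `(F, G)`-coderivation. -/
def IsCoder (F G Z : TensorAlgebra k M →ₗ[k] TensorAlgebra k N) : Prop :=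
  comul ∘ₗ Z = (TensorProduct.map F Z + TensorProduct.map Z G) ∘ₗ comul ∧
    counit ∘ₗ Z = (0 : _ →ₗ[k] k)

theorem IsCoalgMap.conv_comp {F : TensorAlgebra k M →ₗ[k] TensorAlgebra k N} (hF : IsCoalgMap F)
    (X Y : TensorAlgebra k N →ₗ[k] R) : (X ⋆ Y) ∘ₗ F = (X ∘ₗ F) ⋆ (Y ∘ₗ F) := by
  simp only [conv_eq, LinearMap.comp_assoc, hF.1, TensorProduct.map_comp]

theorem IsCoalgMap.convUnit_comp {F : TensorAlgebra k M →ₗ[k] TensorAlgebra k N}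
    (hF : IsCoalgMap F) : convUnit k N R ∘ₗ F = convUnit k M R := by
  rw [convUnit_eq, LinearMap.comp_assoc, hF.2, convUnit_eq]

theorem IsCoder.conv_comp {F G Z : TensorAlgebra k M →ₗ[k] TensorAlgebra k N}
    (hZ : IsCoder F G Z) (X Y : TensorAlgebra k N →ₗ[k] R) :
    (X ⋆ Y) ∘ₗ Z = (X ∘ₗ F) ⋆ (Y ∘ₗ Z) + (X ∘ₗ Z) ⋆ (Y ∘ₗ G) := by
  simp only [conv_eq, LinearMap.comp_assoc, hZ.1, TensorProduct.map_comp, LinearMap.comp_add,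
    LinearMap.add_comp]

theorem IsCoder.convUnit_comp {F G Z : TensorAlgebra k M →ₗ[k] TensorAlgebra k N}
    (hZ : IsCoder F G Z) : convUnit k N R ∘ₗ Z = 0 := by
  rw [convUnit_eq, LinearMap.comp_assoc, hZ.2, LinearMap.comp_zero]

/-- The inclusion of the left tensor factor. -/
noncomputable abbrev inclL (k N : Type) [Field k] [AddCommGroup N] [Module k N] :
    TensorAlgebra k N →ₗ[k] TensorAlgebra k N ⊗[k] TensorAlgebra k N :=
  (Algebra.TensorProduct.includeLeft : _ →ₐ[k] _).toLinearMap

/-- The inclusion of the right tensor factor. -/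
noncomputable abbrev inclR (k N : Type) [Field k] [AddCommGroup N] [Module k N] :
    TensorAlgebra k N →ₗ[k] TensorAlgebra k N ⊗[k] TensorAlgebra k N :=
  (Algebra.TensorProduct.includeRight : _ →ₐ[k] _).toLinearMap

theorem map_comp_comul (X Y : TensorAlgebra k M →ₗ[k] TensorAlgebra k N) :
    TensorProduct.map X Y ∘ₗ comul = (inclL k N ∘ₗ X) ⋆ (inclR k N ∘ₗ Y) := by
  rw [conv_eq, ← LinearMap.comp_assoc]
  congr 1
  ext1
  ext
  simp

theorem comul_comp_conv (X Y : TensorAlgebra k M →ₗ[k] TensorAlgebra k N) :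
    comul ∘ₗ (X ⋆ Y) = (comul ∘ₗ X) ⋆ (inclR k N ∘ₗ Y) + (inclL k N ∘ₗ X) ⋆ (comul ∘ₗ Y)
      - (inclL k N ∘ₗ X) ⋆ (inclR k N ∘ₗ Y) := by
  simp only [conv_eq, ← LinearMap.comp_assoc, ← LinearMap.add_comp, ← LinearMap.sub_comp]
  congr 1
  refine TensorProduct.ext' fun a b => ?_
  simp [comul_mul]

theorem comul_comp_ι (z : TensorAlgebra k M →ₗ[k] N) :
    comul ∘ₗ (ι k ∘ₗ z) = inclL k N ∘ₗ (ι k ∘ₗ z) + inclR k N ∘ₗ (ι k ∘ₗ z) := by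
  refine LinearMap.ext fun t => ?_
  simp [comul_ι, add_comm]

theorem comul_comp_convUnit :
    comul ∘ₗ convUnit k M (TensorAlgebra k N) =
      convUnit k M (TensorAlgebra k N ⊗[k] TensorAlgebra k N) := by
  refine LinearMap.ext fun t => ?_
  simp [convUnit_eq, Algebra.algebraMap_eq_smul_one, comul_one, Algebra.TensorProduct.one_def]

theorem counit_comp_conv (X Y : TensorAlgebra k M →ₗ[k] TensorAlgebra k N) :
    counit ∘ₗ (X ⋆ Y) = conv (R := k) (counit ∘ₗ X) (counit ∘ₗ Y) :=
  algHom_comp_conv TensorAlgebra.algebraMapInv X Y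

theorem counit_comp_ι (z : TensorAlgebra k M →ₗ[k] N) :
    counit ∘ₗ (ι k ∘ₗ z) = (0 : _ →ₗ[k] k) := by
  refine LinearMap.ext fun t => ?_
  simp [counit_ι]

theorem isCoder_conv {F G : TensorAlgebra k M →ₗ[k] TensorAlgebra k N} (hF : IsCoalgMap F)
    (hG : IsCoalgMap G) (z : TensorAlgebra k M →ₗ[k] N) : IsCoder F G (F ⋆ (ι k ∘ₗ z) ⋆ G) := by
  have h1 := hF.1
  have h2 := hG.1
  rw [map_comp_comul] at h1 h2
  constructor
  · rw [LinearMap.add_comp, map_comp_comul, map_comp_comul, comul_comp_conv, comul_comp_conv,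
      comul_comp_ι, h1, h2]
    simp only [algHom_comp_conv, conv_add, add_conv, conv_sub, conv_assoc]
    abel
  · rw [counit_comp_conv, counit_comp_conv, counit_comp_ι, zero_conv, conv_zero]

theorem ιInv_one : ιInv (1 : TensorAlgebra k M) = 0 := by
  let : Module kᵐᵒᵖ M := Module.compHom _ ((RingHom.id k).fromOpposite mul_comm)
  have : IsCentralScalar k M := ⟨fun r m => rfl⟩
  simp [ιInv]

theorem ιInv_mul (s t : TensorAlgebra k M) :
    ιInv (s * t) = counit (R := k) s • ιInv t + counit (R := k) t • ιInv s := by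
  let : Module kᵐᵒᵖ M := Module.compHom _ ((RingHom.id k).fromOpposite mul_comm)
  have : IsCentralScalar k M := ⟨fun r m => rfl⟩
  have h : (TrivSqZeroExt.fstHom k k M).comp (toTrivSqZeroExt (R := k) (M := M)) =
      TensorAlgebra.algebraMapInv := by
    ext; simp [TensorAlgebra.algebraMapInv]
  have h' : ∀ u : TensorAlgebra k M, (toTrivSqZeroExt u).fst = counit (R := k) u := fun u =>
    AlgHom.congr_fun h u
  simp [ιInv, h', TrivSqZeroExt.snd_mul]

theorem ιInv_ι (x : M) : ιInv (ι k x) = x := ι_leftInverse x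

theorem ιInv_comp_conv_left {X Y : TensorAlgebra k M →ₗ[k] TensorAlgebra k N}
    (hX : counit ∘ₗ X = (counit : _ →ₗ[k] k)) (hY : counit ∘ₗ Y = (0 : _ →ₗ[k] k)) :
    ιInv ∘ₗ (X ⋆ Y) = ιInv ∘ₗ Y := by
  refine LinearMap.ext fun t => ?_
  have e := (ℛ k t).convMul_apply (toConv X) (toConv Y)
  change (X ⋆ Y) t = _ at e
  have hX' : ∀ t, counit (R := k) (X t) = counit (R := k) t := LinearMap.congr_fun hX
  have hY' : ∀ t, counit (R := k) (Y t) = 0 := LinearMap.congr_fun hY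
  simp only [LinearMap.comp_apply, e, map_sum, ιInv_mul, hX', hY', zero_smul, add_zero]
  conv_rhs => rw [← sum_counit_smul (R := k) (ℛ k t)]
  simp

theorem ιInv_comp_conv_right {X Y : TensorAlgebra k M →ₗ[k] TensorAlgebra k N}
    (hX : counit ∘ₗ X = (0 : _ →ₗ[k] k)) (hY : counit ∘ₗ Y = (counit : _ →ₗ[k] k)) :
    ιInv ∘ₗ (X ⋆ Y) = ιInv ∘ₗ X := by
  refine LinearMap.ext fun t => ?_
  have e := (ℛ k t).convMul_apply (toConv X) (toConv Y)
  change (X ⋆ Y) t = _ at e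
  have hX' : ∀ t, counit (R := k) (X t) = 0 := LinearMap.congr_fun hX
  have hY' : ∀ t, counit (R := k) (Y t) = counit (R := k) t := LinearMap.congr_fun hY
  have e2 := congrArg (TensorProduct.rid k _) (sum_tmul_counit_eq (R := k) (ℛ k t))
  simp only [map_sum, TensorProduct.rid_tmul, one_smul] at e2
  simp only [LinearMap.comp_apply, e, map_sum, ιInv_mul, hX', hY', zero_smul, zero_add]
  conv_rhs => rw [← e2]
  simp

theorem ιInv_comp_conv {F G : TensorAlgebra k M →ₗ[k] TensorAlgebra k N} (hF : IsCoalgMap F)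
    (hG : IsCoalgMap G) (z : TensorAlgebra k M →ₗ[k] N) :
    ιInv ∘ₗ (F ⋆ (ι k ∘ₗ z) ⋆ G) = z := by
  rw [ιInv_comp_conv_left hF.2, ιInv_comp_conv_right (counit_comp_ι z) hG.2]
  · ext t; simp [ιInv_ι]
  · rw [counit_comp_conv, counit_comp_ι, zero_conv]

end Convolution

section Geometric

open TensorAlgebra TensorProduct Coalgebra WithConv

variable {k}
variable {M : Type} [AddCommGroup M] [Module k M]
variable {N : Type} [AddCommGroup N] [Module k N]
variable {P : Type} [AddCommGroup P] [Module k P]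
variable {R : Type} [Ring R] [Algebra k R]

local infixr:72 "⋆" => conv

/-- `X` vanishes on all words of length less than `n`. -/
def VanishBelow (n : ℕ) (X : TensorAlgebra k M →ₗ[k] N) : Prop :=
  ∀ l : List M, l.length < n → X (word l) = 0

namespace VanishBelow

variable {n m : ℕ} {X Y : TensorAlgebra k M →ₗ[k] N}

theorem zero_index (X : TensorAlgebra k M →ₗ[k] N) : VanishBelow 0 X :=
  fun _ hl => absurd hl (Nat.not_lt_zero _)

theorem one_iff : VanishBelow 1 X ↔ X 1 = 0 := by
  constructor
  · intro h
    simpa using h [] (by simp)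
  · intro h l hl
    obtain rfl : l = [] := List.length_eq_zero_iff.mp (by omega)
    simpa using h

theorem mono (h : VanishBelow m X) (hnm : n ≤ m) : VanishBelow n X :=
  fun l hl => h l (hl.trans_le hnm)

theorem add (hX : VanishBelow n X) (hY : VanishBelow n Y) : VanishBelow n (X + Y) :=
  fun l hl => by rw [LinearMap.add_apply, hX l hl, hY l hl, add_zero]

theorem sub (hX : VanishBelow n X) (hY : VanishBelow n Y) : VanishBelow n (X - Y) :=
  fun l hl => by rw [LinearMap.sub_apply, hX l hl, hY l hl, sub_zero]

theorem comp (hX : VanishBelow n X) (g : N →ₗ[k] P) : VanishBelow n (g ∘ₗ X) :=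
  fun l hl => by rw [LinearMap.comp_apply, hX l hl, map_zero]

theorem conv {X Y : TensorAlgebra k M →ₗ[k] R} (hX : VanishBelow n X) (hY : VanishBelow m Y) :
    VanishBelow (n + m) (X ⋆ Y) := by
  intro l hl
  rw [conv_word]
  refine Finset.sum_eq_zero fun i hi' => ?_
  rw [Finset.mem_range] at hi'
  rcases lt_or_ge i n with hi | hi
  · rw [hX _ (by simp; omega), zero_mul]
  · rw [hY _ (by simp; omega), mul_zero]

theorem eq_zero (h : ∀ n, VanishBelow n X) : X = 0 :=
  ext_word fun l => h (l.length + 1) l (Nat.lt_succ_self _)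

theorem eq_zero_of_step (h : ∀ n, VanishBelow n X → VanishBelow (n + 1) X) : X = 0 :=
  eq_zero fun n => Nat.rec (zero_index X) (fun n => h n) n

end VanishBelow

/-- The linear map given by `x n` on words of length `n`. -/
noncomputable def gather (x : ℕ → TensorAlgebra k M →ₗ[k] N) : TensorAlgebra k M →ₗ[k] N :=
  DirectSum.toModule k ℕ N (fun n => x n ∘ₗ TensorPower.toTensorAlgebra) ∘ₗ
    (TensorAlgebra.equivDirectSum (R := k) (M := M)).toLinearMap

theorem gather_word (x : ℕ → TensorAlgebra k M →ₗ[k] N) (l : List M) :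
    gather x (word l) = x l.length (word l) := by
  have h := tprod_eq_word (k := k) (fun i : Fin l.length => l.get i)
  rw [List.ofFn_get] at h
  have h2 := TensorPower.toTensorAlgebra_tprod (R := k) (fun i : Fin l.length => l.get i)
  rw [h] at h2
  rw [← h2]
  have h3 : TensorAlgebra.equivDirectSum (R := k) (M := M)
      (TensorPower.toTensorAlgebra (PiTensorProduct.tprod k fun i => l.get i)) =
      DirectSum.of (fun n => ⨂[k]^n M) l.length (PiTensorProduct.tprod k fun i => l.get i) := by
    rw [h2, ← h]
    exact TensorAlgebra.toDirectSum_tensorPower_tprod _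
  simp only [gather, LinearMap.comp_apply, AlgEquiv.toLinearMap_apply]
  rw [h3]
  exact DirectSum.toModule_lof k l.length _

theorem exists_fixed_point (P : (TensorAlgebra k M →ₗ[k] N) → Prop)
    (F : (TensorAlgebra k M →ₗ[k] N) → (TensorAlgebra k M →ₗ[k] N)) (zero : P 0)
    (map : ∀ x, P x → P (F x))
    (loc : ∀ x, (∀ n, ∃ y, P y ∧ VanishBelow n (x - y)) → P x)
    (contr : ∀ n x y, P x → P y → VanishBelow n (x - y) → VanishBelow (n + 1) (F x - F y)) :
    ∃ x, P x ∧ F x = x := by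
  let u : ℕ → TensorAlgebra k M →ₗ[k] N := fun n => F^[n] 0
  have hu : ∀ n, u (n + 1) = F (u n) := fun n => Function.iterate_succ_apply' F n 0
  have hP : ∀ n, P (u n) := by
    intro n
    induction n with
    | zero => exact zero
    | succ n ih => rw [hu]; exact map _ ih
  have h1 : ∀ n m, VanishBelow n (u (n + m) - u n) := by
    intro n m
    induction n with
    | zero => exact VanishBelow.zero_index _
    | succ n ih =>
      rw [add_right_comm, hu, hu]
      exact contr n _ _ (hP _) (hP _) ih
  let x := gather fun n => u (n + 1)
  have hx : ∀ n, VanishBelow n (x - u n) := by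
    intro n l hl
    obtain ⟨m, rfl⟩ := Nat.exists_eq_add_of_lt hl
    have := h1 (l.length + 1) m l (Nat.lt_succ_self _)
    rw [LinearMap.sub_apply, sub_eq_zero, add_right_comm] at this
    rw [LinearMap.sub_apply, sub_eq_zero, gather_word, this]
  have hPx : P x := loc x fun n => ⟨u n, hP n, hx n⟩
  refine ⟨x, hPx, sub_eq_zero.mp (VanishBelow.eq_zero fun n => ?_)⟩
  have h2 := (contr n _ _ hPx (hP n) (hx n)).sub (hx (n + 1))
  rw [hu, sub_sub_sub_cancel_right] at h2
  exact h2.mono n.le_succ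

theorem conv_fixed_unique {F P X Y : TensorAlgebra k M →ₗ[k] R} (hF : F 1 = 0)
    (hX : X = P + F ⋆ X) (hY : Y = P + F ⋆ Y) : X = Y := by
  refine sub_eq_zero.mp (VanishBelow.eq_zero_of_step fun n hn => ?_)
  have h : X - Y = F ⋆ (X - Y) := by
    rw [conv_sub]
    conv_lhs => rw [hX, hY]
    abel
  rw [h, add_comm]
  exact (VanishBelow.one_iff.mpr hF).conv hn

theorem exists_geom {ψ : TensorAlgebra k M →ₗ[k] N} (hψ : ψ 1 = 0) :
    ∃ G, G = convUnit k M (TensorAlgebra k N) + (ι k ∘ₗ ψ) ⋆ G := by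
  obtain ⟨G, -, hG⟩ := exists_fixed_point (fun _ => True)
    (fun G => convUnit k M (TensorAlgebra k N) + (ι k ∘ₗ ψ) ⋆ G) trivial (fun _ _ => trivial)
    (fun _ _ => trivial) (fun n x y _ _ h => by
      rw [add_sub_add_left_eq_sub, ← conv_sub, add_comm]
      exact ((VanishBelow.one_iff.mpr hψ).comp _).conv h)
  exact ⟨G, hG.symm⟩

open Classical in
/-- The coalgebra map with corestriction `ψ`, i.e. `∑ₛ (ι ∘ ψ)^{⋆ s}` (when `ψ 1 = 0`). -/
noncomputable def geom (ψ : TensorAlgebra k M →ₗ[k] N) :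
    TensorAlgebra k M →ₗ[k] TensorAlgebra k N :=
  if h : ψ 1 = 0 then (exists_geom h).choose else 0

variable {ψ φ : TensorAlgebra k M →ₗ[k] N}

theorem geom_eq (hψ : ψ 1 = 0) :
    geom ψ = convUnit k M (TensorAlgebra k N) + (ι k ∘ₗ ψ) ⋆ geom ψ := by
  rw [geom, dif_pos hψ]
  exact (exists_geom hψ).choose_spec

theorem ι_comp_one (hψ : ψ 1 = 0) : (ι k ∘ₗ ψ) 1 = 0 := by
  rw [LinearMap.comp_apply, hψ, map_zero]

theorem eq_geom_conv (hψ : ψ 1 = 0) {X Y : TensorAlgebra k M →ₗ[k] TensorAlgebra k N}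
    (hX : X = Y + (ι k ∘ₗ ψ) ⋆ X) : X = geom ψ ⋆ Y := by
  refine conv_fixed_unique (ι_comp_one hψ) hX ?_
  conv_lhs => rw [geom_eq hψ, add_conv, convUnit_conv, conv_assoc]

theorem eq_geom (hψ : ψ 1 = 0) {X : TensorAlgebra k M →ₗ[k] TensorAlgebra k N}
    (hX : X = convUnit k M (TensorAlgebra k N) + (ι k ∘ₗ ψ) ⋆ X) : X = geom ψ :=
  conv_fixed_unique (ι_comp_one hψ) hX (geom_eq hψ)

theorem geom_eq' (hψ : ψ 1 = 0) :
    geom ψ = convUnit k M (TensorAlgebra k N) + geom ψ ⋆ (ι k ∘ₗ ψ) := by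
  refine (eq_geom hψ ?_).symm
  conv_lhs => rw [geom_eq hψ]
  rw [add_conv, convUnit_conv, conv_add, conv_convUnit, conv_assoc]

theorem geom_one (hψ : ψ 1 = 0) : geom ψ 1 = 1 := by
  rw [geom_eq hψ, LinearMap.add_apply, conv_one_apply, ι_comp_one hψ, convUnit_one, zero_mul,
    add_zero]

theorem isCoalgMap_geom (hψ : ψ 1 = 0) : IsCoalgMap (geom ψ) := by
  constructor
  · rw [map_comp_comul]
    refine conv_fixed_unique (F := inclL k N ∘ₗ (ι k ∘ₗ ψ)) (P := inclR k N ∘ₗ geom ψ) ?_ ?_ ?_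
    · rw [LinearMap.comp_apply, ι_comp_one hψ, map_zero]
    · conv_lhs => rw [geom_eq hψ]
      rw [LinearMap.comp_add, comul_comp_conv, comul_comp_convUnit, comul_comp_ι, add_conv]
      have h : inclR k N ∘ₗ geom ψ =
          convUnit k M _ + (inclR k N ∘ₗ ι k ∘ₗ ψ) ⋆ (inclR k N ∘ₗ geom ψ) := by
        conv_lhs => rw [geom_eq hψ]
        rw [LinearMap.comp_add, algHom_comp_conv, algHom_comp_convUnit]
      conv_rhs => rw [h]
      abel
    · conv_lhs => rw [geom_eq hψ, LinearMap.comp_add, algHom_comp_conv, algHom_comp_convUnit,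
        add_conv, convUnit_conv, conv_assoc, ← geom_eq hψ]
  · rw [geom_eq hψ, LinearMap.comp_add, counit_comp_conv, counit_comp_ι, zero_conv, add_zero]
    refine LinearMap.ext fun t => ?_
    simp [convUnit_eq, counit, Algebra.algebraMap_eq_smul_one]

theorem ιInv_comp_geom (hψ : ψ 1 = 0) : ιInv ∘ₗ geom ψ = ψ := by
  rw [geom_eq hψ, LinearMap.comp_add,
    ιInv_comp_conv_right (counit_comp_ι ψ) (isCoalgMap_geom hψ).2]
  refine LinearMap.ext fun t => ?_
  simp [ιInv_ι, convUnit_eq, Algebra.algebraMap_eq_smul_one, ιInv_one]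

theorem conv_ι_mul (X Y : TensorAlgebra k M →ₗ[k] R) (x : M) (t : TensorAlgebra k M) :
    (X ⋆ Y) (ι k x * t) =
      X 1 * Y (ι k x * t) + ((X ∘ₗ LinearMap.mulLeft k (ι k x)) ⋆ Y) t := by
  rw [conv_apply, conv_apply, comul_ι_mul, map_add, map_add, TensorProduct.map_tmul,
    LinearMap.mul'_apply]
  congr 2
  generalize comul (R := k) t = s
  induction s using TensorProduct.induction_on with
  | zero => simp
  | add a b ha hb => rw [mul_add, map_add, map_add, ha, hb]
  | tmul a b => simp

theorem geom_ιInv : geom (ιInv : TensorAlgebra k M →ₗ[k] M) = LinearMap.id := by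
  refine (eq_geom ιInv_one (ext_word fun l => ?_)).symm
  cases l with
  | nil => simp [conv_one_apply, convUnit_one, ιInv_one]
  | cons x l =>
    rw [LinearMap.add_apply, convUnit_word_cons, word_cons, conv_ι_mul, ι_comp_one ιInv_one]
    have h : (ι k ∘ₗ ιInv) ∘ₗ LinearMap.mulLeft k (ι k x) =
        LinearMap.mulLeft k (ι k x) ∘ₗ convUnit k M _ := by
      refine LinearMap.ext fun t => ?_
      simp [ιInv_mul, counit_ι, ιInv_ι, convUnit_eq, Algebra.algebraMap_eq_smul_one]
    rw [h, conv_word, Finset.sum_eq_single 0]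
    · simp [convUnit_one]
    · intro i hi hi0
      obtain ⟨i, rfl⟩ := Nat.exists_eq_succ_of_ne_zero hi0
      cases l with
      | nil => simp at hi
      | cons y l => rw [List.take_succ_cons, LinearMap.comp_apply, convUnit_word_cons, map_zero,
          zero_mul]
    · simp

theorem isCoalgMap_id : IsCoalgMap (LinearMap.id : _ →ₗ[k] TensorAlgebra k M) := by
  rw [← geom_ιInv]
  exact isCoalgMap_geom ιInv_one

/-- The algebra endomorphism of the tensor algebra induced by a linear map. -/
noncomputable def tmap (σ : M →ₗ[k] N) : TensorAlgebra k M →ₐ[k] TensorAlgebra k N :=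
  TensorAlgebra.lift k (ι k ∘ₗ σ)

theorem tmap_comp_ι (σ : N →ₗ[k] P) (z : TensorAlgebra k M →ₗ[k] N) :
    (tmap σ).toLinearMap ∘ₗ (ι k ∘ₗ z) = ι k ∘ₗ (σ ∘ₗ z) := by
  refine LinearMap.ext fun t => ?_
  simp [tmap]

theorem tmap_comp_geom (σ : N →ₗ[k] P) (hψ : ψ 1 = 0) :
    (tmap σ).toLinearMap ∘ₗ geom ψ = geom (σ ∘ₗ ψ) := by
  refine eq_geom ?_ ?_
  · rw [LinearMap.comp_apply, hψ, map_zero]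
  · conv_lhs => rw [geom_eq hψ, LinearMap.comp_add, algHom_comp_conv, algHom_comp_convUnit,
      tmap_comp_ι]

theorem tmap_eq_geom (σ : M →ₗ[k] N) : (tmap σ).toLinearMap = geom (σ ∘ₗ ιInv) := by
  rw [← tmap_comp_geom σ ιInv_one, geom_ιInv, LinearMap.comp_id]

theorem isCoalgMap_tmap (σ : M →ₗ[k] N) : IsCoalgMap (tmap σ).toLinearMap := by
  rw [tmap_eq_geom]
  exact isCoalgMap_geom (by rw [LinearMap.comp_apply, ιInv_one, map_zero])

theorem comp_geom_one {χ : TensorAlgebra k N →ₗ[k] P} (hχ : χ 1 = 0) (hψ : ψ 1 = 0) :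
    (χ ∘ₗ geom ψ) 1 = 0 := by
  rw [LinearMap.comp_apply, geom_one hψ, hχ]

theorem geom_comp_geom {χ : TensorAlgebra k N →ₗ[k] P} (hχ : χ 1 = 0) (hψ : ψ 1 = 0) :
    geom χ ∘ₗ geom ψ = geom (χ ∘ₗ geom ψ) := by
  refine eq_geom (comp_geom_one hχ hψ) ?_
  conv_lhs => rw [geom_eq hχ, LinearMap.add_comp, (isCoalgMap_geom hψ).conv_comp,
    (isCoalgMap_geom hψ).convUnit_comp]
  rfl

theorem geom_sub_geom (hψ : ψ 1 = 0) (hφ : φ 1 = 0) :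
    geom ψ - geom φ = geom ψ ⋆ (ι k ∘ₗ (ψ - φ)) ⋆ geom φ := by
  have h1 : (ι k ∘ₗ φ) ⋆ geom φ = geom φ - convUnit k M _ :=
    eq_sub_of_add_eq' (geom_eq hφ).symm
  have h2 : geom ψ ⋆ (ι k ∘ₗ ψ) = geom ψ - convUnit k M _ :=
    eq_sub_of_add_eq' (geom_eq' hψ).symm
  rw [LinearMap.comp_sub, sub_conv, conv_sub, ← conv_assoc, h1, h2, sub_conv, conv_sub,
    convUnit_conv, conv_convUnit]
  abel

theorem VanishBelow.comp_conv {n : ℕ} {z : TensorAlgebra k M →ₗ[k] N} (hz : VanishBelow n z)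
    {β : TensorAlgebra k N →ₗ[k] P} (hβ : β ∘ₗ ι k = 0)
    {F G : TensorAlgebra k M →ₗ[k] TensorAlgebra k N} (hF : F 1 = 1) (hG : G 1 = 1) :
    VanishBelow (n + 1) (β ∘ₗ (F ⋆ (ι k ∘ₗ z) ⋆ G)) := by
  have hF' : VanishBelow 1 (F - convUnit k M _) := by
    rw [VanishBelow.one_iff, LinearMap.sub_apply, hF, convUnit_one, sub_self]
  have hG' : VanishBelow 1 (G - convUnit k M _) := by
    rw [VanishBelow.one_iff, LinearMap.sub_apply, hG, convUnit_one, sub_self]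
  have hz' := hz.comp (ι k)
  have e : F ⋆ (ι k ∘ₗ z) ⋆ G = (F - convUnit k M _) ⋆ (ι k ∘ₗ z) ⋆ G
      + (ι k ∘ₗ z) ⋆ (G - convUnit k M _) + ι k ∘ₗ z := by
    simp only [sub_conv, conv_sub, convUnit_conv, conv_convUnit]
    abel
  rw [e, LinearMap.comp_add, ← LinearMap.comp_assoc z, hβ, LinearMap.zero_comp, add_zero]
  refine VanishBelow.comp (VanishBelow.add ?_ (hz'.conv hG')) β
  exact (hF'.conv (hz'.conv (VanishBelow.zero_index G))).mono (by omega)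

end Geometric

section Grading

open TensorAlgebra TensorProduct Coalgebra WithConv

variable {k}
variable {M : Type} [AddCommGroup M] [Module k M]
variable {N : Type} [AddCommGroup N] [Module k N]
variable {P : Type} [AddCommGroup P] [Module k P]

local infixr:72 "⋆" => conv

/-- `X` is homogeneous of degree `c` with respect to the gradings `G` and `G'`. -/
def IsHomog (G : ℤ → Submodule k M) (G' : ℤ → Submodule k N) (c : ℤ) (X : M →ₗ[k] N) : Prop :=
  ∀ p, ∀ x ∈ G p, X x ∈ G' (p + c)

namespace IsHomog

variable {G : ℤ → Submodule k M} {G' : ℤ → Submodule k N} {G'' : ℤ → Submodule k P} {a b c : ℤ}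

theorem zero : IsHomog G G' c 0 := fun _ _ _ => Submodule.zero_mem _

theorem add {X Y : M →ₗ[k] N} (hX : IsHomog G G' c X) (hY : IsHomog G G' c Y) :
    IsHomog G G' c (X + Y) := fun p x hx => Submodule.add_mem _ (hX p x hx) (hY p x hx)

theorem comp {X : M →ₗ[k] N} {Y : N →ₗ[k] P} (hY : IsHomog G' G'' b Y) (hX : IsHomog G G' a X)
    (h : a + b = c) : IsHomog G G'' c (Y ∘ₗ X) := by
  intro p x hx
  have := hY _ _ (hX p x hx)
  rwa [add_assoc, h] at this

end IsHomog

/-- `s` is the sign operator of the grading `G`. -/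
def IsSign (G : ℤ → Submodule k M) (s : M →ₗ[k] M) : Prop :=
  ∀ p, ∀ x ∈ G p, s x = (-1 : k) ^ p • x

theorem ext_of_iSup_eq_top {G : ℤ → Submodule k M} (hG : ⨆ p, G p = ⊤) {X Y : M →ₗ[k] N}
    (h : ∀ p, ∀ x ∈ G p, X x = Y x) : X = Y := by
  have : ⨆ p, G p ≤ LinearMap.eqLocus X Y := iSup_le fun p x hx => h p x hx
  rw [hG, top_le_iff] at this
  exact LinearMap.eqLocus_eq_top.mp this

theorem IsSign.comp_self {G : ℤ → Submodule k M} {s : M →ₗ[k] M} (hs : IsSign G s)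
    (hG : ⨆ p, G p = ⊤) : s ∘ₗ s = LinearMap.id := by
  refine ext_of_iSup_eq_top hG fun p x hx => ?_
  rw [LinearMap.comp_apply, hs p x hx, map_smul, hs p x hx, smul_smul, ← mul_zpow]
  simp

theorem IsHomog.sign_comp {G : ℤ → Submodule k M} {G' : ℤ → Submodule k N} {c : ℤ}
    {X : M →ₗ[k] N} (hX : IsHomog G G' c X) (hG : ⨆ p, G p = ⊤) {s : M →ₗ[k] M} {s' : N →ₗ[k] N}
    (hs : IsSign G s) (hs' : IsSign G' s') : s' ∘ₗ X = (-1 : k) ^ c • (X ∘ₗ s) := by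
  refine ext_of_iSup_eq_top hG fun p x hx => ?_
  rw [LinearMap.comp_apply, LinearMap.smul_apply, LinearMap.comp_apply, hs p x hx,
    hs' _ _ (hX p x hx), map_smul, smul_smul, ← zpow_add₀ (by simp), add_comm]

theorem IsSign.isHomog {G : ℤ → Submodule k M} {s : M →ₗ[k] M} (hs : IsSign G s) :
    IsHomog G G 0 s := by
  intro p x hx
  rw [hs p x hx, add_zero]
  exact Submodule.smul_mem _ _ hx

/-- `l` is a list of homogeneous elements of total degree `p`. -/
inductive HomogList (gr : ℤ → Submodule k M) : List M → ℤ → Prop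
  | nil : HomogList gr [] 0
  | cons {x : M} {l : List M} {p q : ℤ} : x ∈ gr p → HomogList gr l q →
      HomogList gr (x :: l) (p + q)

theorem HomogList.append {gr : ℤ → Submodule k M} {l l' : List M} {p q : ℤ}
    (hl : HomogList gr l p) (hl' : HomogList gr l' q) : HomogList gr (l ++ l') (p + q) := by
  induction hl with
  | nil => simpa
  | cons hx _ ih => rw [add_assoc]; exact ih.cons hx

theorem HomogList.take_drop {gr : ℤ → Submodule k M} {l : List M} {p : ℤ}
    (hl : HomogList gr l p) (i : ℕ) :
    ∃ a b, HomogList gr (l.take i) a ∧ HomogList gr (l.drop i) b ∧ a + b = p := by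
  induction hl generalizing i with
  | nil => exact ⟨0, 0, by simpa using .nil, by simpa using .nil, add_zero 0⟩
  | @cons x l p q hx hl ih =>
    cases i with
    | zero => exact ⟨0, p + q, .nil, .cons hx hl, zero_add _⟩
    | succ i =>
      obtain ⟨a, b, ha, hb, rfl⟩ := ih i
      exact ⟨p + a, b, .cons hx ha, hb, add_assoc _ _ _⟩

/-- The total grading of the tensor algebra induced by a grading of the module. -/
def tensorGrading (gr : ℤ → Submodule k M) (p : ℤ) : Submodule k (TensorAlgebra k M) :=
  Submodule.span k {t | ∃ l, HomogList gr l p ∧ t = word l}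

variable {gr : ℤ → Submodule k M} {gr' : ℤ → Submodule k N}

theorem word_mem_tensorGrading {l : List M} {p : ℤ} (hl : HomogList gr l p) :
    word l ∈ tensorGrading gr p := Submodule.subset_span ⟨l, hl, rfl⟩

theorem one_mem_tensorGrading : (1 : TensorAlgebra k M) ∈ tensorGrading gr 0 := by
  simpa using word_mem_tensorGrading (gr := gr) .nil

theorem ι_isHomog : IsHomog gr (tensorGrading gr) 0 (ι k) := by
  intro p x hx
  simpa using word_mem_tensorGrading (HomogList.nil.cons hx)

theorem mul_mem_tensorGrading {s t : TensorAlgebra k M} {p q : ℤ} (hs : s ∈ tensorGrading gr p)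
    (ht : t ∈ tensorGrading gr q) : s * t ∈ tensorGrading gr (p + q) := by
  induction hs using Submodule.span_induction with
  | mem s hs =>
    obtain ⟨l, hl, rfl⟩ := hs
    induction ht using Submodule.span_induction with
    | mem t ht =>
      obtain ⟨l', hl', rfl⟩ := ht
      rw [← word_append]
      exact word_mem_tensorGrading (hl.append hl')
    | zero => simp
    | add a b _ _ ha hb => rw [mul_add]; exact Submodule.add_mem _ ha hb
    | smul r a _ ha => rw [mul_smul_comm]; exact Submodule.smul_mem _ r ha
  | zero => simp
  | add a b _ _ ha hb => rw [add_mul]; exact Submodule.add_mem _ ha hb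
  | smul r a _ ha => rw [smul_mul_assoc]; exact Submodule.smul_mem _ r ha

theorem iSup_tensorGrading (hgr : ⨆ p, gr p = ⊤) : ⨆ p, tensorGrading gr p = ⊤ := by
  have key : ∀ (x : M), ∀ t ∈ ⨆ p, tensorGrading gr p, ι k x * t ∈ ⨆ p, tensorGrading gr p := by
    intro x t ht
    have hx : x ∈ ⨆ p, gr p := hgr ▸ Submodule.mem_top
    induction hx using Submodule.iSup_induction' with
    | zero => simp
    | add a b _ _ ha hb => rw [map_add, add_mul]; exact Submodule.add_mem _ ha hb
    | mem p x hx =>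
      induction ht using Submodule.iSup_induction' with
      | zero => simp
      | add a b _ _ ha hb => rw [mul_add]; exact Submodule.add_mem _ ha hb
      | mem q t ht =>
        exact Submodule.mem_iSup_of_mem _ (mul_mem_tensorGrading (ι_isHomog p x hx) ht)
  rw [eq_top_iff, ← span_range_word, Submodule.span_le]
  rintro _ ⟨l, rfl⟩
  induction l with
  | nil => exact Submodule.mem_iSup_of_mem 0 (by simpa using one_mem_tensorGrading)
  | cons x l ih => rw [word_cons]; exact key x _ ih

theorem isHomog_of_word {G : ℤ → Submodule k P} {c : ℤ} {X : TensorAlgebra k M →ₗ[k] P}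
    (h : ∀ l p, HomogList gr l p → X (word l) ∈ G (p + c)) :
    IsHomog (tensorGrading gr) G c X := by
  intro p t ht
  have : tensorGrading gr p ≤ (G (p + c)).comap X := by
    refine Submodule.span_le.mpr ?_
    rintro _ ⟨l, hl, rfl⟩
    exact h l p hl
  exact this ht

theorem IsHomog.conv {X Y : TensorAlgebra k M →ₗ[k] TensorAlgebra k N} {a b c : ℤ}
    (hX : IsHomog (tensorGrading gr) (tensorGrading gr') a X)
    (hY : IsHomog (tensorGrading gr) (tensorGrading gr') b Y) (h : a + b = c) :
    IsHomog (tensorGrading gr) (tensorGrading gr') c (X ⋆ Y) := by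
  refine isHomog_of_word fun l p hl => ?_
  rw [conv_word]
  refine Submodule.sum_mem _ fun i _ => ?_
  obtain ⟨p, q, hp, hq, rfl⟩ := hl.take_drop i
  have := mul_mem_tensorGrading (hX _ _ (word_mem_tensorGrading hp))
    (hY _ _ (word_mem_tensorGrading hq))
  rwa [add_add_add_comm, h] at this

theorem convUnit_isHomog :
    IsHomog (tensorGrading gr) (tensorGrading gr') 0 (convUnit k M (TensorAlgebra k N)) := by
  refine isHomog_of_word fun l p hl => ?_
  cases hl with
  | nil => simpa [convUnit_one] using one_mem_tensorGrading
  | cons _ _ => rw [convUnit_word_cons]; exact Submodule.zero_mem _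

theorem ιInv_isHomog : IsHomog (tensorGrading gr) gr 0 ιInv := by
  refine isHomog_of_word fun l p hl => ?_
  cases hl with
  | nil => simp [ιInv_one]
  | cons hx hl =>
    cases hl with
    | nil => simpa [ιInv_ι] using hx
    | cons _ _ => simp [ιInv_mul, counit_ι, counit_mul]

theorem IsHomog.geom {ψ : TensorAlgebra k M →ₗ[k] N} (hψ : ψ 1 = 0)
    (h : IsHomog (tensorGrading gr) gr' 0 ψ) :
    IsHomog (tensorGrading gr) (tensorGrading gr') 0 (geom ψ) := by
  refine isHomog_of_word fun l => ?_
  induction hn : l.length using Nat.strong_induction_on generalizing l with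
  | _ n ih =>
    intro p hl
    rw [geom_eq hψ, LinearMap.add_apply, conv_word]
    refine Submodule.add_mem _ (convUnit_isHomog _ _ (word_mem_tensorGrading hl))
      (Submodule.sum_mem _ fun i hi => ?_)
    rw [Finset.mem_range] at hi
    cases i with
    | zero => simp [hψ]
    | succ i =>
      obtain ⟨p, q, hp, hq, rfl⟩ := hl.take_drop (i + 1)
      have h1 := ih _ (by simp; omega) (l.drop (i + 1)) rfl q hq
      have h2 := ι_isHomog _ _ (h _ _ (word_mem_tensorGrading hp))
      have := mul_mem_tensorGrading h2 h1
      simpa using this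

theorem isSign_tmap {s : M →ₗ[k] M} (hs : IsSign gr s) :
    IsSign (tensorGrading gr) (tmap s).toLinearMap := by
  intro p
  have : tensorGrading gr p ≤ LinearMap.eqLocus (tmap s).toLinearMap ((-1 : k) ^ p • .id) := by
    refine Submodule.span_le.mpr ?_
    rintro _ ⟨l, hl, rfl⟩
    rw [SetLike.mem_coe, LinearMap.mem_eqLocus]
    induction hl with
    | nil => simp
    | cons hx _ ih =>
      rw [AlgHom.toLinearMap_apply] at ih ⊢
      rw [word_cons, map_mul, ih, tmap, lift_ι_apply, LinearMap.comp_apply, hs _ _ hx,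
        zpow_add₀ (by simp)]
      simp [smul_smul, mul_comm]
  exact fun t ht => this ht

theorem tmap_isHomog {s : M →ₗ[k] M} (hs : IsSign gr s) :
    IsHomog (tensorGrading gr) (tensorGrading gr) 0 (tmap s).toLinearMap :=
  (isSign_tmap hs).isHomog

end Grading

section Transfer

open TensorAlgebra TensorProduct Coalgebra WithConv

variable {k}
variable {M : Type} [AddCommGroup M] [Module k M]
variable {N : Type} [AddCommGroup N] [Module k N]
variable {P : Type} [AddCommGroup P] [Module k P]

local infixr:72 "⋆" => conv

/-- The coderivation with corestriction `b`, where `σ` is the sign operator. -/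
noncomputable def coderiv (σ : M →ₗ[k] M) (b : TensorAlgebra k M →ₗ[k] M) :
    TensorAlgebra k M →ₗ[k] TensorAlgebra k M :=
  (tmap σ).toLinearMap ⋆ (ι k ∘ₗ b) ⋆ LinearMap.id

theorem isCoder_coderiv (σ : M →ₗ[k] M) (b : TensorAlgebra k M →ₗ[k] M) :
    IsCoder (tmap σ).toLinearMap LinearMap.id (coderiv σ b) :=
  isCoder_conv (isCoalgMap_tmap σ) isCoalgMap_id b

theorem ιInv_coderiv (σ : M →ₗ[k] M) (b : TensorAlgebra k M →ₗ[k] M) (t : TensorAlgebra k M) :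
    ιInv (coderiv σ b t) = b t :=
  LinearMap.congr_fun (ιInv_comp_conv (isCoalgMap_tmap σ) isCoalgMap_id b) t

theorem coderiv_comp_geom (τ : N →ₗ[k] N) (ν : TensorAlgebra k N →ₗ[k] N)
    {ψ : TensorAlgebra k M →ₗ[k] N} (hψ : ψ 1 = 0) :
    coderiv τ ν ∘ₗ geom ψ = geom (τ ∘ₗ ψ) ⋆ (ι k ∘ₗ (ν ∘ₗ geom ψ)) ⋆ geom ψ := by
  rw [coderiv, (isCoalgMap_geom hψ).conv_comp, (isCoalgMap_geom hψ).conv_comp, tmap_comp_geom τ hψ]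
  rfl

theorem geom_comp_coderiv {σ : M →ₗ[k] M} (b : TensorAlgebra k M →ₗ[k] M) {τ : N →ₗ[k] N}
    {ψ : TensorAlgebra k M →ₗ[k] N} (hψ : ψ 1 = 0) (h : ψ ∘ₗ (tmap σ).toLinearMap = τ ∘ₗ ψ) :
    geom ψ ∘ₗ coderiv σ b = geom (τ ∘ₗ ψ) ⋆ (ι k ∘ₗ (ψ ∘ₗ coderiv σ b)) ⋆ geom ψ := by
  refine eq_geom_conv (by rw [LinearMap.comp_apply, hψ, map_zero]) ?_
  conv_lhs => rw [geom_eq hψ, LinearMap.add_comp, (isCoder_coderiv σ b).conv_comp,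
    (isCoder_coderiv σ b).convUnit_comp, LinearMap.comp_assoc, h, LinearMap.comp_id, zero_add,
    add_comm]
  rfl

theorem coderiv_comp_geom_sub {σ : M →ₗ[k] M} (b : TensorAlgebra k M →ₗ[k] M) {τ : N →ₗ[k] N}
    (ν : TensorAlgebra k N →ₗ[k] N) {ψ : TensorAlgebra k M →ₗ[k] N} (hψ : ψ 1 = 0)
    (h : ψ ∘ₗ (tmap σ).toLinearMap = τ ∘ₗ ψ) :
    coderiv τ ν ∘ₗ geom ψ - geom ψ ∘ₗ coderiv σ b =
      geom (τ ∘ₗ ψ) ⋆ (ι k ∘ₗ (ν ∘ₗ geom ψ - ψ ∘ₗ coderiv σ b)) ⋆ geom ψ := by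
  rw [coderiv_comp_geom τ ν hψ, geom_comp_coderiv b hψ h, LinearMap.comp_sub, sub_conv, conv_sub]

/-- The coalgebra homotopy attached to a contraction whose target coalgebra map is `Θ`. -/
noncomputable abbrev homotopy (σ : M →ₗ[k] M) (η : TensorAlgebra k M →ₗ[k] M)
    (Θ : TensorAlgebra k M →ₗ[k] TensorAlgebra k M) :
    TensorAlgebra k M →ₗ[k] TensorAlgebra k M :=
  (tmap σ).toLinearMap ⋆ (ι k ∘ₗ η) ⋆ Θ

variable {gr : ℤ → Submodule k M} {gr' : ℤ → Submodule k N}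

theorem isHomog_of_vanishBelow {G : ℤ → Submodule k P} {c : ℤ} {X : TensorAlgebra k M →ₗ[k] P}
    (h : ∀ n, ∃ Y, IsHomog (tensorGrading gr) G c Y ∧ VanishBelow n (X - Y)) :
    IsHomog (tensorGrading gr) G c X := by
  refine isHomog_of_word fun l p hl => ?_
  obtain ⟨Y, hY, hXY⟩ := h (l.length + 1)
  have := hXY l (Nat.lt_succ_self _)
  rw [LinearMap.sub_apply, sub_eq_zero] at this
  rw [this]
  exact hY _ _ (word_mem_tensorGrading hl)

theorem map_one_of_vanishBelow {X : TensorAlgebra k M →ₗ[k] P}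
    (h : ∀ n, ∃ Y : TensorAlgebra k M →ₗ[k] P, Y 1 = 0 ∧ VanishBelow n (X - Y)) : X 1 = 0 := by
  obtain ⟨Y, hY, hXY⟩ := h 1
  rw [VanishBelow.one_iff, LinearMap.sub_apply, hY, sub_zero] at hXY
  exact hXY

/-- A homogeneous coalgebra map inverting `f` up to homotopy is obtained by summing trees. -/
theorem exists_backward {β : TensorAlgebra k M →ₗ[k] M} {g : N →ₗ[k] M} {h : M →ₗ[k] M}
    (hβ : IsHomog (tensorGrading gr) gr 1 β) (hg : IsHomog gr' gr 0 g)
    (hh : IsHomog gr gr (-1) h) (β_one : β 1 = 0) (β_ι : β ∘ₗ ι k = 0) :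
    ∃ ψ : TensorAlgebra k N →ₗ[k] M, ψ 1 = 0 ∧ IsHomog (tensorGrading gr') gr 0 ψ ∧
      g ∘ₗ ιInv + h ∘ₗ β ∘ₗ geom ψ = ψ := by
  obtain ⟨ψ, ⟨h1, h2⟩, h3⟩ := exists_fixed_point
    (fun ψ : TensorAlgebra k N →ₗ[k] M => ψ 1 = 0 ∧ IsHomog (tensorGrading gr') gr 0 ψ)
    (fun ψ => g ∘ₗ ιInv + h ∘ₗ β ∘ₗ geom ψ) ⟨rfl, IsHomog.zero⟩
    (fun ψ hψ => ⟨by simp [ιInv_one, geom_one hψ.1, β_one],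
      (hg.comp ιInv_isHomog (zero_add 0)).add
        (hh.comp (hβ.comp (hψ.2.geom hψ.1) (zero_add 1)) (add_neg_cancel 1))⟩)
    (fun ψ hψ => ⟨map_one_of_vanishBelow fun n => (hψ n).imp fun Y hY => ⟨hY.1.1, hY.2⟩,
      isHomog_of_vanishBelow fun n => (hψ n).imp fun Y hY => ⟨hY.1.2, hY.2⟩⟩)
    (fun n x y hx hy hxy => by
      rw [add_sub_add_left_eq_sub, ← LinearMap.comp_sub, ← LinearMap.comp_sub,
        geom_sub_geom hx.1 hy.1]
      exact (hxy.comp_conv β_ι (geom_one hx.1) (geom_one hy.1)).comp h)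
  exact ⟨ψ, h1, h2, h3⟩

theorem vanishBelow_comp_geom {β : TensorAlgebra k M →ₗ[k] M} (β_one : β 1 = 0)
    (β_ι : β ∘ₗ ι k = 0) {ψ : TensorAlgebra k N →ₗ[k] M} (hψ : ψ 1 = 0) :
    VanishBelow 2 (β ∘ₗ geom ψ) := by
  have h := (VanishBelow.one_iff.mpr hψ).comp_conv β_ι
    (F := convUnit k N _) convUnit_one (geom_one hψ)
  have h0 : β ∘ₗ convUnit k N _ = 0 := by
    refine LinearMap.ext fun t => ?_
    simp [convUnit_eq, Algebra.algebraMap_eq_smul_one, β_one]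
  rw [geom_eq hψ, LinearMap.comp_add, h0, zero_add]
  rwa [convUnit_conv] at h

theorem exists_forward {β : TensorAlgebra k M →ₗ[k] M} {f : M →ₗ[k] N} {h : M →ₗ[k] M}
    {σ : M →ₗ[k] M} (hσ : IsSign gr σ) {ψ : TensorAlgebra k N →ₗ[k] M} (ψ_one : ψ 1 = 0)
    (hψ : IsHomog (tensorGrading gr') gr 0 ψ)
    (hβ : IsHomog (tensorGrading gr) gr 1 β) (hf : IsHomog gr gr' 0 f)
    (hh : IsHomog gr gr (-1) h) (β_ι : β ∘ₗ ι k = 0) :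
    ∃ q : TensorAlgebra k M →ₗ[k] M, q 1 = 0 ∧ IsHomog (tensorGrading gr) gr 0 q ∧
      ιInv + β ∘ₗ homotopy σ (h ∘ₗ q) (geom ψ ∘ₗ geom (f ∘ₗ q)) = q := by
  have comp_one : ∀ {q : TensorAlgebra k M →ₗ[k] M}, q 1 = 0 →
      (f ∘ₗ q) 1 = 0 ∧ (h ∘ₗ q) 1 = 0 := fun hq => by simp [hq]
  have Θ_one : ∀ {q : TensorAlgebra k M →ₗ[k] M}, q 1 = 0 →
      (geom ψ ∘ₗ geom (f ∘ₗ q)) 1 = 1 := fun hq => by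
    rw [LinearMap.comp_apply, geom_one (comp_one hq).1, geom_one ψ_one]
  obtain ⟨q, ⟨h1, h2⟩, h3⟩ := exists_fixed_point
    (fun q : TensorAlgebra k M →ₗ[k] M => q 1 = 0 ∧ IsHomog (tensorGrading gr) gr 0 q)
    (fun q => ιInv + β ∘ₗ homotopy σ (h ∘ₗ q) (geom ψ ∘ₗ geom (f ∘ₗ q))) ⟨rfl, IsHomog.zero⟩
    (fun q hq => ⟨by simp [ιInv_one, conv_one_apply, hq.1],
      ιInv_isHomog.add (hβ.comp ((tmap_isHomog hσ).conv
        ((ι_isHomog.comp (hh.comp hq.2 (zero_add _)) (add_zero _)).conv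
          ((hψ.geom ψ_one).comp ((hf.comp hq.2 (zero_add 0)).geom (comp_one hq.1).1) (zero_add 0))
          (add_zero _)) (zero_add _)) (neg_add_cancel 1))⟩)
    (fun q hq => ⟨map_one_of_vanishBelow fun n => (hq n).imp fun Y hY => ⟨hY.1.1, hY.2⟩,
      isHomog_of_vanishBelow fun n => (hq n).imp fun Y hY => ⟨hY.1.2, hY.2⟩⟩)
    (fun n x y hx hy hxy => by
      have e : homotopy σ (h ∘ₗ x) (geom ψ ∘ₗ geom (f ∘ₗ x)) -
          homotopy σ (h ∘ₗ y) (geom ψ ∘ₗ geom (f ∘ₗ y)) =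
          homotopy σ (h ∘ₗ (x - y)) (geom ψ ∘ₗ geom (f ∘ₗ x)) +
          (tmap σ).toLinearMap ⋆ (ι k ∘ₗ h ∘ₗ y) ⋆
            (geom ψ ∘ₗ (geom (f ∘ₗ x) - geom (f ∘ₗ y))) := by
        simp only [homotopy, LinearMap.comp_sub, conv_sub, sub_conv]
        abel
      rw [add_sub_add_left_eq_sub, ← LinearMap.comp_sub, e, LinearMap.comp_add]
      refine ((hxy.comp h).comp_conv β_ι (map_one (tmap σ)) (Θ_one hx.1)).add
        (VanishBelow.comp ?_ β)
      have hy' : VanishBelow 1 (ι k ∘ₗ h ∘ₗ y) :=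
        ((VanishBelow.one_iff.mpr hy.1).comp h).comp (ι k)
      have hxy' : VanishBelow n (geom ψ ∘ₗ (geom (f ∘ₗ x) - geom (f ∘ₗ y))) := by
        rw [geom_sub_geom (comp_one hx.1).1 (comp_one hy.1).1, ← LinearMap.comp_sub]
        refine VanishBelow.comp ?_ _
        exact ((VanishBelow.zero_index _).conv
          (((hxy.comp f).comp (ι k)).conv (VanishBelow.zero_index _))).mono (by omega)
      exact ((VanishBelow.zero_index _).conv (hy'.conv hxy')).mono (by omega))
  exact ⟨q, h1, h2, h3⟩

end Transfer

section TransferEquations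

open TensorAlgebra TensorProduct Coalgebra WithConv

variable {k}
variable {M : Type} [AddCommGroup M] [Module k M]
variable {N : Type} [AddCommGroup N] [Module k N]

local infixr:72 "⋆" => conv

/-- An A∞-structure `d ∘ ιInv + β` on `M`, in coalgebraic form, with a chain map `f : M → N`, a
chain map `g` back and a homotopy `h` from `1` to `g ∘ f`. -/
structure TransferDatum (gr : ℤ → Submodule k M) (gr' : ℤ → Submodule k N)
    (σ : M →ₗ[k] M) (τ : N →ₗ[k] N) (d : M →ₗ[k] M) (β : TensorAlgebra k M →ₗ[k] M)
    (dN : N →ₗ[k] N) (f : M →ₗ[k] N) (g : N →ₗ[k] M) (h : M →ₗ[k] M) : Prop where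
  iSup_gr : ⨆ p, gr p = ⊤
  iSup_gr' : ⨆ p, gr' p = ⊤
  sign : IsSign gr σ
  sign' : IsSign gr' τ
  d_homog : IsHomog gr gr 1 d
  β_homog : IsHomog (tensorGrading gr) gr 1 β
  dN_homog : IsHomog gr' gr' 1 dN
  f_homog : IsHomog gr gr' 0 f
  g_homog : IsHomog gr' gr 0 g
  h_homog : IsHomog gr gr (-1) h
  d_d : ∀ x, d (d x) = 0
  dN_dN : ∀ x, dN (dN x) = 0
  f_d : ∀ x, f (d x) = dN (f x)
  d_g : ∀ x, d (g x) = g (dN x)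
  d_h : ∀ x, d (h x) = g (f x) - x - h (d x)
  β_one : β 1 = 0
  β_ι : β ∘ₗ ι k = 0
  square : ∀ t, (d ∘ₗ ιInv + β) (coderiv σ (d ∘ₗ ιInv + β) t) = 0

namespace TransferDatum

variable {gr : ℤ → Submodule k M} {gr' : ℤ → Submodule k N}
    {σ : M →ₗ[k] M} {τ : N →ₗ[k] N} {d : M →ₗ[k] M} {β : TensorAlgebra k M →ₗ[k] M}
    {dN : N →ₗ[k] N} {f : M →ₗ[k] N} {g : N →ₗ[k] M} {h : M →ₗ[k] M}

theorem b_homog (D : TransferDatum gr gr' σ τ d β dN f g h) :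
    IsHomog (tensorGrading gr) gr 1 (d ∘ₗ ιInv + β) :=
  (D.d_homog.comp ιInv_isHomog (zero_add 1)).add D.β_homog

theorem d_β (D : TransferDatum gr gr' σ τ d β dN f g h) (t : TensorAlgebra k M) :
    d (β t) = -β (coderiv σ (d ∘ₗ ιInv + β) t) := by
  have := D.square t
  rw [LinearMap.add_apply, LinearMap.comp_apply, ιInv_coderiv, LinearMap.add_apply,
    LinearMap.comp_apply, map_add, D.d_d, zero_add] at this
  exact eq_neg_of_add_eq_zero_left this

theorem comp_tmap_of_homog {V : Type} [AddCommGroup V] [Module k V] {W : Type} [AddCommGroup W]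
    [Module k W] {G : ℤ → Submodule k V} {G' : ℤ → Submodule k W} (hG : ⨆ p, G p = ⊤)
    {s : V →ₗ[k] V} {s' : W →ₗ[k] W} (hs : IsSign G s) (hs' : IsSign G' s')
    {ψ : TensorAlgebra k V →ₗ[k] W} (hψ : IsHomog (tensorGrading G) G' 0 ψ) :
    ψ ∘ₗ (tmap s).toLinearMap = s' ∘ₗ ψ := by
  rw [hψ.sign_comp (iSup_tensorGrading hG) (isSign_tmap hs) hs']
  simp

/-- The operation transferred along the tree sum `ψ`. -/
theorem coderiv_comp_backward (D : TransferDatum gr gr' σ τ d β dN f g h)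
    {ψ : TensorAlgebra k N →ₗ[k] M} (ψ_one : ψ 1 = 0)
    (hψ : IsHomog (tensorGrading gr') gr 0 ψ) (ψ_eq : g ∘ₗ ιInv + h ∘ₗ β ∘ₗ geom ψ = ψ) :
    coderiv σ (d ∘ₗ ιInv + β) ∘ₗ geom ψ =
      geom ψ ∘ₗ coderiv τ (dN ∘ₗ ιInv + f ∘ₗ β ∘ₗ geom ψ) := by
  set ν : TensorAlgebra k N →ₗ[k] N := dN ∘ₗ ιInv + f ∘ₗ β ∘ₗ geom ψ with hν
  set e := (d ∘ₗ ιInv + β) ∘ₗ geom ψ - ψ ∘ₗ coderiv τ ν with he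
  have hE := coderiv_comp_geom_sub (σ := τ) (τ := σ) ν (d ∘ₗ ιInv + β) ψ_one
    (comp_tmap_of_homog D.iSup_gr' D.sign' D.sign hψ)
  rw [← he] at hE
  have ψ_apply : ∀ t, ψ t = g (ιInv t) + h (β (geom ψ t)) := fun t =>
    (LinearMap.congr_fun ψ_eq t).symm
  have e_eq : e = h ∘ₗ β ∘ₗ (geom (σ ∘ₗ ψ) ⋆ (ι k ∘ₗ e) ⋆ geom ψ) := by
    rw [← hE]
    refine LinearMap.ext fun t => ?_
    have h1 : ιInv (geom ψ t) = ψ t := LinearMap.congr_fun (ιInv_comp_geom ψ_one) t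
    simp only [he, LinearMap.sub_apply, LinearMap.add_apply, LinearMap.comp_apply, h1, map_sub]
    rw [ψ_apply (coderiv τ ν t), ιInv_coderiv]
    simp only [hν, LinearMap.add_apply, LinearMap.comp_apply, map_add]
    rw [ψ_apply t, map_add, D.d_g, D.d_h, D.d_β]
    simp only [map_neg]
    abel
  have σψ_one : (σ ∘ₗ ψ) 1 = 0 := by rw [LinearMap.comp_apply, ψ_one, map_zero]
  have : e = 0 := VanishBelow.eq_zero_of_step fun n hn => by
    rw [e_eq]
    exact (hn.comp_conv D.β_ι (geom_one σψ_one) (geom_one ψ_one)).comp h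
  rw [this, LinearMap.comp_zero, zero_conv, conv_zero] at hE
  exact sub_eq_zero.mp hE

theorem square_backward (D : TransferDatum gr gr' σ τ d β dN f g h)
    {ψ : TensorAlgebra k N →ₗ[k] M} (ψ_one : ψ 1 = 0)
    (hψ : IsHomog (tensorGrading gr') gr 0 ψ) (ψ_eq : g ∘ₗ ιInv + h ∘ₗ β ∘ₗ geom ψ = ψ)
    (t : TensorAlgebra k N) :
    (dN ∘ₗ ιInv + f ∘ₗ β ∘ₗ geom ψ)
      (coderiv τ (dN ∘ₗ ιInv + f ∘ₗ β ∘ₗ geom ψ) t) = 0 := by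
  have h1 := LinearMap.congr_fun (D.coderiv_comp_backward ψ_one hψ ψ_eq) t
  rw [LinearMap.comp_apply, LinearMap.comp_apply] at h1
  rw [LinearMap.add_apply]
  simp only [LinearMap.comp_apply]
  rw [ιInv_coderiv, ← h1]
  simp only [LinearMap.add_apply, LinearMap.comp_apply, map_add, D.dN_dN]
  rw [← D.f_d, D.d_β]
  simp

theorem morphism_forward (D : TransferDatum gr gr' σ τ d β dN f g h)
    {ψ : TensorAlgebra k N →ₗ[k] M} (ψ_one : ψ 1 = 0)
    (hψ : IsHomog (tensorGrading gr') gr 0 ψ) (ψ_eq : g ∘ₗ ιInv + h ∘ₗ β ∘ₗ geom ψ = ψ)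
    {q : TensorAlgebra k M →ₗ[k] M} (q_one : q 1 = 0) (hq : IsHomog (tensorGrading gr) gr 0 q)
    (q_eq : ιInv + β ∘ₗ homotopy σ (h ∘ₗ q) (geom ψ ∘ₗ geom (f ∘ₗ q)) = q) :
    (f ∘ₗ q) ∘ₗ coderiv σ (d ∘ₗ ιInv + β) =
      (dN ∘ₗ ιInv + f ∘ₗ β ∘ₗ geom ψ) ∘ₗ geom (f ∘ₗ q) := by
  have hDΨ := D.coderiv_comp_backward ψ_one hψ ψ_eq
  have b_homog := D.b_homog
  set b : TensorAlgebra k M →ₗ[k] M := d ∘ₗ ιInv + β with hb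
  set ν : TensorAlgebra k N →ₗ[k] N := dN ∘ₗ ιInv + f ∘ₗ β ∘ₗ geom ψ with hν
  set φ : TensorAlgebra k M →ₗ[k] N := f ∘ₗ q with hφ
  set η : TensorAlgebra k M →ₗ[k] M := h ∘ₗ q with hη
  have φ_one : φ 1 = 0 := by rw [hφ, LinearMap.comp_apply, q_one, map_zero]
  have η_one : η 1 = 0 := by rw [hη, LinearMap.comp_apply, q_one, map_zero]
  have φ_homog : IsHomog (tensorGrading gr) gr' 0 φ := D.f_homog.comp hq (zero_add 0)
  set Θ := geom ψ ∘ₗ geom φ with hΘ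
  set θ : TensorAlgebra k M →ₗ[k] M := ψ ∘ₗ geom φ with hθ
  have θ_one : θ 1 = 0 := comp_geom_one ψ_one φ_one
  have hΘθ : Θ = geom θ := geom_comp_geom ψ_one φ_one
  have Θ_coalg : IsCoalgMap Θ := hΘθ ▸ isCoalgMap_geom θ_one
  set S := (tmap σ).toLinearMap with hS
  set H := homotopy σ η Θ with hH
  set E := coderiv σ b with hE
  have Hcoder : IsCoder S Θ H := isCoder_conv (isCoalgMap_tmap σ) Θ_coalg η
  have Ecoder : IsCoder S LinearMap.id E := isCoder_coderiv σ b
  have SS : S ∘ₗ S = LinearMap.id :=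
    (isSign_tmap D.sign).comp_self (iSup_tensorGrading D.iSup_gr)
  have bS : σ ∘ₗ b = -(b ∘ₗ S) := by
    rw [b_homog.sign_comp (iSup_tensorGrading D.iSup_gr) (isSign_tmap D.sign) D.sign]; simp [hS]
  have ηS : σ ∘ₗ η = -(η ∘ₗ S) := by
    rw [(D.h_homog.comp hq (zero_add (-1))).sign_comp (iSup_tensorGrading D.iSup_gr)
      (isSign_tmap D.sign) D.sign]
    simp [hS, hη]
  set x := φ ∘ₗ E - ν ∘ₗ geom φ with hx
  set X := geom φ ∘ₗ E - coderiv τ ν ∘ₗ geom φ with hX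
  set Y := E ∘ₗ H + H ∘ₗ E - Θ + LinearMap.id with hY
  set y := b ∘ₗ H + η ∘ₗ E - θ + ιInv with hy
  have Hπ : ∀ t, ιInv (H t) = η t := fun t =>
    LinearMap.congr_fun (ιInv_comp_conv (isCoalgMap_tmap σ) Θ_coalg η) t
  have hXeq : X = geom (τ ∘ₗ φ) ⋆ (ι k ∘ₗ x) ⋆ geom φ := by
    have := coderiv_comp_geom_sub b ν φ_one (comp_tmap_of_homog D.iSup_gr D.sign D.sign' φ_homog)
    rw [hX, ← neg_sub, this, hx, ← neg_sub (ν ∘ₗ geom φ), LinearMap.comp_neg, neg_conv, conv_neg]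
  have hYeq : Y = LinearMap.id ⋆ (ι k ∘ₗ y) ⋆ Θ -
      LinearMap.id ⋆ (ι k ∘ₗ (σ ∘ₗ η)) ⋆ (geom ψ ∘ₗ X) := by
    have e1 : E ∘ₗ H = LinearMap.id ⋆ (ι k ∘ₗ (b ∘ₗ S)) ⋆ H +
        LinearMap.id ⋆ (ι k ∘ₗ (b ∘ₗ H)) ⋆ Θ + (S ∘ₗ H) ⋆ (ι k ∘ₗ (b ∘ₗ Θ)) ⋆ Θ := by
      rw [hE, coderiv, Hcoder.conv_comp, Hcoder.conv_comp, Θ_coalg.conv_comp, conv_add, ← hS, SS]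
      rfl
    have e2 : H ∘ₗ E = LinearMap.id ⋆ (ι k ∘ₗ (η ∘ₗ S)) ⋆ (Θ ∘ₗ E) +
        LinearMap.id ⋆ (ι k ∘ₗ (η ∘ₗ E)) ⋆ Θ + (S ∘ₗ E) ⋆ (ι k ∘ₗ η) ⋆ Θ := by
      rw [hH, homotopy, Ecoder.conv_comp, Ecoder.conv_comp, conv_add, ← hS, SS]
      rfl
    have e3 : (LinearMap.id ⋆ (ι k ∘ₗ (b ∘ₗ S)) ⋆ H : _ →ₗ[k] TensorAlgebra k M) =
        -((S ∘ₗ E) ⋆ (ι k ∘ₗ η) ⋆ Θ) := by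
      have : S ∘ₗ E = (S ∘ₗ S) ⋆ (ι k ∘ₗ (σ ∘ₗ b)) ⋆ S := by
        rw [hE, coderiv, hS, algHom_comp_conv, algHom_comp_conv, tmap_comp_ι, LinearMap.comp_id]
      rw [this, SS, bS, LinearMap.comp_neg, neg_conv, conv_neg, neg_conv, neg_neg, conv_assoc,
        conv_assoc, hH, homotopy]
    have e4 : (S ∘ₗ H) ⋆ (ι k ∘ₗ (b ∘ₗ Θ)) ⋆ Θ =
        LinearMap.id ⋆ (ι k ∘ₗ (σ ∘ₗ η)) ⋆ (E ∘ₗ Θ) := by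
      have h1 : S ∘ₗ H = (S ∘ₗ S) ⋆ (ι k ∘ₗ (σ ∘ₗ η)) ⋆ (S ∘ₗ Θ) := by
        rw [hH, homotopy, hS, algHom_comp_conv, algHom_comp_conv, tmap_comp_ι]
      have h2 : E ∘ₗ Θ = (S ∘ₗ Θ) ⋆ (ι k ∘ₗ (b ∘ₗ Θ)) ⋆ Θ := by
        rw [hE, coderiv, Θ_coalg.conv_comp, Θ_coalg.conv_comp]
        rfl
      rw [h1, h2, SS, conv_assoc, conv_assoc]
    have e5 : Θ ∘ₗ E = E ∘ₗ Θ + geom ψ ∘ₗ X := by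
      rw [hX, hΘ, LinearMap.comp_sub, ← LinearMap.comp_assoc (geom φ) (geom ψ) E, hDΨ,
        ← LinearMap.comp_assoc, LinearMap.comp_assoc (geom φ), LinearMap.comp_assoc]
      abel
    have e6 : LinearMap.id - Θ = LinearMap.id ⋆ (ι k ∘ₗ (ιInv - θ)) ⋆ Θ := by
      rw [hΘθ, ← geom_ιInv]
      exact geom_sub_geom ιInv_one θ_one
    have e7 : Y = E ∘ₗ H + H ∘ₗ E + (LinearMap.id - Θ) := by rw [hY]; abel
    have e8 : y = b ∘ₗ H + η ∘ₗ E + (ιInv - θ) := by rw [hy]; abel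
    have e9 : η ∘ₗ S = -(σ ∘ₗ η) := by rw [ηS, neg_neg]
    rw [e7, e8, e1, e2, e3, e4, e5, e6, e9]
    simp only [LinearMap.comp_add, LinearMap.comp_neg, conv_add, add_conv, neg_conv, conv_neg]
    abel
  have q_apply : ∀ t, q t = ιInv t + β (H t) := fun t => (LinearMap.congr_fun q_eq t).symm
  have ψ_apply : ∀ t, ψ t = g (ιInv t) + h (β (geom ψ t)) := fun t =>
    (LinearMap.congr_fun ψ_eq t).symm
  have φπ : ∀ t, ιInv (geom φ t) = φ t := fun t => LinearMap.congr_fun (ιInv_comp_geom φ_one) t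
  have Eπ : ∀ t, ιInv (E t) = b t := ιInv_coderiv σ b
  have dβ : ∀ t, d (β t) = -β (E t) := D.d_β
  have x_eq : x = f ∘ₗ β ∘ₗ Y := by
    refine LinearMap.ext fun t => ?_
    simp only [hx, hν, hY, hφ, LinearMap.sub_apply, LinearMap.add_apply, LinearMap.comp_apply,
      map_sub, map_add, LinearMap.id_apply]
    rw [φπ, hφ, LinearMap.comp_apply, q_apply, q_apply, ← D.f_d, Eπ]
    simp only [hb, hΘ, LinearMap.add_apply, LinearMap.comp_apply, map_add, dβ, map_neg]
    abel
  have y_eq : y = h ∘ₗ β ∘ₗ Y := by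
    refine LinearMap.ext fun t => ?_
    simp only [hy, hb, hη, hY, hθ, LinearMap.sub_apply, LinearMap.add_apply, LinearMap.comp_apply,
      map_sub, map_add, LinearMap.id_apply]
    rw [Hπ, hη, LinearMap.comp_apply, ψ_apply, φπ, hφ, LinearMap.comp_apply, D.d_h, q_apply t,
      q_apply (E t), Eπ]
    simp only [hb, hΘ, LinearMap.add_apply, LinearMap.comp_apply, map_add, dβ, map_neg]
    abel
  have step : ∀ n, VanishBelow n x ∧ VanishBelow n y := by
    intro n
    induction n with
    | zero => exact ⟨VanishBelow.zero_index x, VanishBelow.zero_index y⟩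
    | succ n ih =>
      have hXn : VanishBelow n X := by
        rw [hXeq]
        exact ((VanishBelow.zero_index _).conv
          ((ih.1.comp (ι k)).conv (VanishBelow.zero_index _))).mono (by omega)
      have hYn : VanishBelow (n + 1) (β ∘ₗ Y) := by
        rw [hYeq, LinearMap.comp_sub]
        refine VanishBelow.sub (ih.2.comp_conv D.β_ι rfl (hΘθ ▸ geom_one θ_one))
          (VanishBelow.comp ?_ β)
        have hη' : VanishBelow 1 (ι k ∘ₗ σ ∘ₗ η) :=
          ((VanishBelow.one_iff.mpr η_one).comp σ).comp (ι k)
        exact ((VanishBelow.zero_index _).conv (hη'.conv (hXn.comp (geom ψ)))).mono (by omega)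
      exact ⟨x_eq ▸ hYn.comp f, y_eq ▸ hYn.comp h⟩
  exact sub_eq_zero.mp (VanishBelow.eq_zero fun n => (step n).1)

theorem exists_transfer (D : TransferDatum gr gr' σ τ d β dN f g h) :
    ∃ (ν : TensorAlgebra k N →ₗ[k] N) (φ : TensorAlgebra k M →ₗ[k] N),
      ν 1 = 0 ∧ φ 1 = 0 ∧ IsHomog (tensorGrading gr') gr' 1 ν ∧
      IsHomog (tensorGrading gr) gr' 0 φ ∧ (∀ t, ν (coderiv τ ν t) = 0) ∧
      (∀ t, φ (coderiv σ (d ∘ₗ ιInv + β) t) = ν (geom φ t)) ∧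
      (∀ y, ν (ι k y) = dN y) ∧ (∀ x, φ (ι k x) = f x) := by
  obtain ⟨ψ, ψ_one, hψ, ψ_eq⟩ :=
    exists_backward D.β_homog D.g_homog D.h_homog D.β_one D.β_ι
  obtain ⟨q, q_one, hq, q_eq⟩ :=
    exists_forward D.sign ψ_one hψ D.β_homog D.f_homog D.h_homog D.β_ι
  have φ_one : (f ∘ₗ q) 1 = 0 := by rw [LinearMap.comp_apply, q_one, map_zero]
  refine ⟨dN ∘ₗ ιInv + f ∘ₗ β ∘ₗ geom ψ, f ∘ₗ q, ?_, φ_one,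
    (D.dN_homog.comp ιInv_isHomog (zero_add 1)).add
      (D.f_homog.comp (D.β_homog.comp (hψ.geom ψ_one) (zero_add 1)) (add_zero 1)),
    D.f_homog.comp hq (zero_add 0), D.square_backward ψ_one hψ ψ_eq,
    LinearMap.congr_fun (D.morphism_forward ψ_one hψ ψ_eq q_one hq q_eq), fun y => ?_, fun x => ?_⟩
  · simp [ιInv_one, geom_one ψ_one, D.β_one]
  · have := vanishBelow_comp_geom D.β_one D.β_ι ψ_one [y] (by simp)
    rw [word_cons, word_nil, mul_one, LinearMap.comp_apply] at this
    simp [this, ιInv_ι]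
  · have η_one : (h ∘ₗ q) 1 = 0 := by rw [LinearMap.comp_apply, q_one, map_zero]
    have := (VanishBelow.one_iff.mpr η_one).comp_conv D.β_ι
      (F := (tmap σ).toLinearMap) (map_one (tmap σ))
      (show (geom ψ ∘ₗ geom (f ∘ₗ q)) 1 = 1 by
        rw [LinearMap.comp_apply, geom_one φ_one, geom_one ψ_one]) [x] (by simp)
    rw [word_cons, word_nil, mul_one] at this
    rw [LinearMap.comp_apply, ← q_eq, LinearMap.add_apply, ιInv_ι]
    exact congrArg f ((congrArg (x + ·) this).trans (add_zero x))

end TransferDatum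

end TransferEquations

section HomologicalAlgebra

open DirectSum

variable {k}
variable {M : Type} [AddCommGroup M] [Module k M]
variable {N : Type} [AddCommGroup N] [Module k N]
variable {P : Type} [AddCommGroup P] [Module k P]

theorem exists_comp_eq_of_ker_le (u : M →ₗ[k] N) (w : M →ₗ[k] P)
    (h : LinearMap.ker u ≤ LinearMap.ker w) : ∃ g : N →ₗ[k] P, ∀ x, g (u x) = w x := by
  obtain ⟨g, hg⟩ := LinearMap.exists_extend
    ((LinearMap.ker u).liftQ w h ∘ₗ u.quotKerEquivRange.symm.toLinearMap)
  refine ⟨g, fun x => ?_⟩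
  have h1 := LinearMap.congr_fun hg ⟨u x, LinearMap.mem_range_self u x⟩
  have h2 : u.quotKerEquivRange.symm ⟨u x, LinearMap.mem_range_self u x⟩ =
      (LinearMap.ker u).mkQ x := by
    rw [LinearEquiv.symm_apply_eq]
    rfl
  simp only [LinearMap.comp_apply, LinearEquiv.coe_coe, h2] at h1
  simpa using h1

theorem exists_generalized_inverse (d : M →ₗ[k] N) :
    ∃ s : N →ₗ[k] M, ∀ x, d (s (d x)) = d x := by
  obtain ⟨r, hr⟩ := d.rangeRestrict.exists_rightInverse_of_surjective d.range_rangeRestrict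
  obtain ⟨s, hs⟩ := LinearMap.exists_extend r
  refine ⟨s, fun x => ?_⟩
  have h1 := LinearMap.congr_fun hs ⟨d x, LinearMap.mem_range_self d x⟩
  have h2 := LinearMap.congr_fun hr ⟨d x, LinearMap.mem_range_self d x⟩
  simp only [LinearMap.comp_apply, Submodule.subtype_apply] at h1
  rw [h1]
  exact congrArg Subtype.val h2

theorem iSup_eq_top_of_isInternal {G : ℤ → Submodule k M} (hG : IsInternal G) : ⨆ p, G p = ⊤ :=
  hG.submodule_iSup_eq_top

theorem exists_glue {G : ℤ → Submodule k M} (hG : IsInternal G) (X : ℤ → M →ₗ[k] N) :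
    ∃ Y : M →ₗ[k] N, ∀ p, ∀ x ∈ G p, Y x = X p x := by
  let e := LinearEquiv.ofBijective (coeLinearMap G) hG
  refine ⟨toModule k ℤ N (fun p => X p ∘ₗ (G p).subtype) ∘ₗ e.symm.toLinearMap, fun p x hx => ?_⟩
  have : e.symm x = lof k ℤ (fun p => G p) p ⟨x, hx⟩ := by
    rw [LinearEquiv.symm_apply_eq]
    exact (coeLinearMap_lof G p ⟨x, hx⟩).symm
  rw [LinearMap.comp_apply, LinearEquiv.coe_coe, this, toModule_lof]
  rfl

theorem exists_isSign {G : ℤ → Submodule k M} (hG : IsInternal G) : ∃ s, IsSign G s :=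
  exists_glue hG fun p => (-1 : k) ^ p • LinearMap.id

/-- The projections of a graded module on its components. -/
theorem exists_proj {G : ℤ → Submodule k M} (hG : IsInternal G) :
    ∃ π : ℤ → M →ₗ[k] M, (∀ p x, π p x ∈ G p) ∧ (∀ p, ∀ x ∈ G p, π p x = x) ∧
      (∀ p q, p ≠ q → ∀ x ∈ G q, π p x = 0) := by
  have h : ∀ p, ∃ π : M →ₗ[k] M, ∀ q, ∀ x ∈ G q,
      π x = (if p = q then LinearMap.id else 0 : M →ₗ[k] M) x := fun p => exists_glue hG _
  choose π hπ using h
  refine ⟨π, fun p x => ?_, fun p x hx => by simp [hπ p p x hx],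
    fun p q hpq x hx => by simp [hπ p q x hx, hpq]⟩
  have hx : x ∈ ⨆ q, G q := iSup_eq_top_of_isInternal hG ▸ Submodule.mem_top
  induction hx using Submodule.iSup_induction' with
  | zero => simp
  | add a b _ _ ha hb => rw [map_add]; exact Submodule.add_mem _ ha hb
  | mem q x hx =>
    rw [hπ p q x hx]
    split_ifs with h
    · subst h; simpa using hx
    · simp

theorem IsHomog.proj_comm {G : ℤ → Submodule k M} {G' : ℤ → Submodule k N} {c : ℤ}
    {X : M →ₗ[k] N} (hX : IsHomog G G' c X) (hG : ⨆ p, G p = ⊤)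
    {π : ℤ → M →ₗ[k] M} {π' : ℤ → N →ₗ[k] N} (hπ : ∀ p, ∀ x ∈ G p, π p x = x)
    (hπ0 : ∀ p q, p ≠ q → ∀ x ∈ G q, π p x = 0) (hπ' : ∀ p, ∀ x ∈ G' p, π' p x = x)
    (hπ0' : ∀ p q, p ≠ q → ∀ x ∈ G' q, π' p x = 0) (p : ℤ) (x : M) :
    π' (p + c) (X x) = X (π p x) := by
  have : π' (p + c) ∘ₗ X = X ∘ₗ π p := by
    refine ext_of_iSup_eq_top hG fun q x hx => ?_
    rw [LinearMap.comp_apply, LinearMap.comp_apply]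
    by_cases h : p = q
    · subst h
      rw [hπ p x hx, hπ' _ _ (hX p x hx)]
    · rw [hπ0 p q h x hx, map_zero, hπ0' _ (q + c) (by omega) _ (hX q x hx)]
  exact LinearMap.congr_fun this x

theorem mem_of_proj_mem {G : ℤ → Submodule k M} (hG : IsInternal G) {π : ℤ → M →ₗ[k] M}
    (hπ : ∀ p, ∀ x ∈ G p, π p x = x) (hπ0 : ∀ p q, p ≠ q → ∀ x ∈ G q, π p x = 0)
    {S : Submodule k M} {x : M} (h : ∀ p, π p x ∈ S) : x ∈ S := by
  have hy : ∀ (y : ⨁ p, G p) p, π p (DirectSum.coeAddMonoidHom G y) = y p := by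
    intro y p
    induction y using DirectSum.induction_on with
    | zero => simp
    | of q z =>
      rw [DirectSum.coeAddMonoidHom_of]
      by_cases hpq : p = q
      · subst hpq
        rw [hπ p _ z.2, DirectSum.of_eq_same]
      · rw [hπ0 p q hpq _ z.2, DirectSum.of_eq_of_ne _ _ _ hpq]
        rfl
    | add a b ha hb =>
      rw [map_add, map_add, ha, hb]
      rfl
  obtain ⟨y, rfl⟩ := hG.surjective x
  classical
  rw [DirectSum.coeAddMonoidHom_eq_dfinsuppSum]
  refine Submodule.sum_mem _ fun p _ => ?_
  have := h p
  rwa [hy] at this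

/-- Data contracting the part of `M` that `f` does not see, when `f` is injective in homology. -/
theorem exists_homotopy_inverse {G : ℤ → Submodule k M} {G' : ℤ → Submodule k N}
    (hG : IsInternal G) (hG' : IsInternal G') {d : M →ₗ[k] M} {dN : N →ₗ[k] N} {f : M →ₗ[k] N}
    (hd : IsHomog G G 1 d) (hdN : IsHomog G' G' 1 dN) (hf : IsHomog G G' 0 f)
    (d_d : ∀ x, d (d x) = 0)
    (hinj : ∀ p, ∀ x ∈ G p, d x = 0 → (∃ w ∈ G' (p - 1), f x = dN w) → ∃ z, x = d z) :
    ∃ (g : N →ₗ[k] M) (h : M →ₗ[k] M), IsHomog G' G 0 g ∧ IsHomog G G (-1) h ∧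
      (∀ x, d (g x) = g (dN x)) ∧ (∀ x, d (h x) = g (f x) - x - h (d x)) := by
  have tG := iSup_eq_top_of_isInternal hG
  have tG' := iSup_eq_top_of_isInternal hG'
  obtain ⟨π, hπm, hπ, hπ0⟩ := exists_proj hG
  obtain ⟨π', hπm', hπ', hπ0'⟩ := exists_proj hG'
  have πd := hd.proj_comm tG hπ hπ0 hπ hπ0
  have πdN := hdN.proj_comm tG' hπ' hπ0' hπ' hπ0'
  have πf := hf.proj_comm tG hπ hπ0 hπ' hπ0'
  obtain ⟨s, hs⟩ := exists_generalized_inverse d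
  obtain ⟨h₀, hh₀⟩ := exists_glue hG fun p => π (p + -1) ∘ₗ s
  have h₀_homog : IsHomog G G (-1) h₀ := fun p x hx => by
    rw [hh₀ p x hx]
    exact hπm _ _
  have h₀_d : ∀ x, d (h₀ (d x)) = d x := by
    have : d ∘ₗ h₀ ∘ₗ d = d := ext_of_iSup_eq_top tG fun p x hx => by
      have := πd (p + 1 + -1) (s (d x))
      simp only [LinearMap.comp_apply]
      rw [hh₀ _ _ (hd p x hx), LinearMap.comp_apply, ← this, hs, neg_add_cancel_right,
        hπ _ _ (hd p x hx)]
    exact LinearMap.congr_fun this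
  have inj : ∀ z w, d z = 0 → f z + dN w = 0 → z ∈ LinearMap.range d := by
    intro z w hz hw
    refine mem_of_proj_mem hG hπ hπ0 fun p => ?_
    obtain ⟨z', hz'⟩ := hinj p (π p z) (hπm p z) (by rw [← πd, hz, map_zero])
      ⟨π' (p - 1) (-w), hπm' _ _, by
        have h1 := πdN (p - 1) (-w)
        have h2 := πf p z
        rw [sub_add_cancel] at h1
        rw [add_zero] at h2
        rw [← h1, ← h2, eq_neg_of_add_eq_zero_left hw, map_neg dN]⟩
    exact ⟨z', hz'.symm⟩
  obtain ⟨g₀, hg₀⟩ := exists_comp_eq_of_ker_le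
    ((f ∘ₗ (LinearMap.ker d).subtype).coprod dN)
    (((LinearMap.id - d ∘ₗ h₀) ∘ₗ (LinearMap.ker d).subtype).coprod (0 : N →ₗ[k] M)) (by
      rintro ⟨⟨z, hz⟩, w⟩ h
      rw [LinearMap.mem_ker] at hz
      obtain ⟨y, rfl⟩ := inj z w hz (by simpa using h)
      simp [h₀_d])
  have g₀_dN : ∀ w, g₀ (dN w) = 0 := fun w => by simpa using hg₀ (0, w)
  have g₀_f : ∀ z, d z = 0 → g₀ (f z) = z - d (h₀ z) := fun z hz => by
    simpa using hg₀ (⟨z, hz⟩, 0)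
  obtain ⟨g, hg⟩ := exists_glue hG' fun p => π p ∘ₗ (LinearMap.id - h₀ ∘ₗ d) ∘ₗ g₀
  have g_homog : IsHomog G' G 0 g := fun p x hx => by
    rw [hg p x hx, add_zero]
    exact hπm _ _
  have d_g : ∀ x, d (g x) = 0 := by
    have : d ∘ₗ g = 0 := ext_of_iSup_eq_top tG' fun p x hx => by
      rw [LinearMap.comp_apply, hg p x hx, LinearMap.comp_apply, ← πd]
      simp [h₀_d]
    exact LinearMap.congr_fun this
  have g_dN : ∀ x, g (dN x) = 0 := by
    have : g ∘ₗ dN = 0 := ext_of_iSup_eq_top tG' fun p x hx => by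
      rw [LinearMap.comp_apply, hg _ _ (hdN p x hx)]
      simp [g₀_dN]
    exact LinearMap.congr_fun this
  have g_f : ∀ z, d z = 0 → g (f z) = z - d (h₀ z) := by
    have : g ∘ₗ f ∘ₗ (LinearMap.id - h₀ ∘ₗ d) =
        (LinearMap.id - d ∘ₗ h₀) ∘ₗ (LinearMap.id - h₀ ∘ₗ d) := by
      refine ext_of_iSup_eq_top tG fun p x hx => ?_
      simp only [LinearMap.comp_apply]
      set z := (LinearMap.id - h₀ ∘ₗ d : M →ₗ[k] M) x with hz
      have hzd : d z = 0 := by simp [hz, h₀_d]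
      have hzp : z ∈ G p := by
        have := h₀_homog _ _ (hd p x hx)
        rw [add_neg_cancel_right] at this
        exact Submodule.sub_mem _ hx this
      have hzh : z - d (h₀ z) ∈ G p := by
        have := hd _ _ (h₀_homog _ _ hzp)
        rw [neg_add_cancel_right] at this
        exact Submodule.sub_mem _ hzp this
      have hfz := hf p z hzp
      rw [add_zero] at hfz
      rw [hg p _ hfz]
      simp only [LinearMap.comp_apply, g₀_f z hzd]
      have : (LinearMap.id - h₀ ∘ₗ d : M →ₗ[k] M) (z - d (h₀ z)) = z - d (h₀ z) := by
        simp [hzd, d_d]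
      rw [this, hπ p _ hzh]
      rfl
    intro z hz
    simpa [hz] using LinearMap.congr_fun this z
  refine ⟨g, -h₀ + g ∘ₗ f ∘ₗ h₀ + d ∘ₗ h₀ ∘ₗ h₀, g_homog, ?_, fun x => by rw [d_g, g_dN],
    fun x => ?_⟩
  · refine (IsHomog.add (fun p x hx => Submodule.neg_mem _ (h₀_homog p x hx))
      (g_homog.comp (hf.comp h₀_homog (add_zero _)) (add_zero _))).add
      (hd.comp (h₀_homog.comp h₀_homog rfl) (by norm_num))
  · have hx := g_f (x - h₀ (d x)) (by rw [map_sub, h₀_d, sub_self])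
    simp only [map_sub] at hx
    simp only [LinearMap.add_apply, LinearMap.neg_apply, LinearMap.comp_apply, map_add, map_neg,
      d_g, d_d]
    rw [sub_eq_iff_eq_add] at hx
    rw [hx]
    abel

end HomologicalAlgebra

section Translation

open TensorAlgebra

variable {k}
variable {M : Type} [AddCommGroup M] [Module k M]
variable {N : Type} [AddCommGroup N] [Module k N]
variable {P : Type} [AddCommGroup P] [Module k P]
variable {gr : ℤ → Submodule k M}

local infixr:72 "⋆" => conv

theorem ofFn_shiftArg {n i j : ℕ} (h : i + j ≤ n) (v : Fin n → M) :
    List.ofFn (shiftArg n i j v) = ((List.ofFn v).drop i).take j := by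
  refine List.ext_getElem (by simp; omega) fun t h1 h2 => ?_
  simp only [List.length_ofFn] at h1
  simp [shiftArg, show i + t < n by omega]

theorem ofFn_insArg {n i j : ℕ} (hi : i < n) (hj : 1 ≤ j) (h : i + j ≤ n) (v : Fin n → M) (x : M) :
    List.ofFn (insArg n i j v x) =
      (List.ofFn v).take i ++ x :: ((List.ofFn v).drop i).drop j := by
  refine List.ext_getElem (by simp; omega) fun t h1 h2 => ?_
  simp only [List.length_ofFn] at h1
  rw [List.getElem_ofFn]
  rcases lt_trichotomy t i with ht | rfl | ht
  · rw [List.getElem_append_left (by simp; omega)]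
    simp [insArg, ht, ht.trans hi]
  · rw [List.getElem_append_right (by simp)]
    simp [insArg, hi.le]
  · obtain ⟨s, rfl⟩ := Nat.exists_eq_add_of_lt ht
    rw [List.getElem_append_right (by simp; omega)]
    have e : i + s + 1 - min i n = s + 1 := by omega
    have e2 : i + s + 1 + j - 1 = i + (j + s) := by omega
    simp only [insArg, List.length_take, List.length_ofFn, e, e2, List.getElem_cons_succ,
      List.getElem_drop, List.getElem_ofFn]
    rw [dif_neg (by omega), if_neg (by omega), dif_pos (by omega)]

theorem homogList_take {n : ℕ} {p : Fin n → ℤ} {v : Fin n → M} (hv : ∀ t, v t ∈ gr (p t))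
    (i : ℕ) : HomogList gr ((List.ofFn v).take i) (partialDeg n i p) := by
  induction i with
  | zero => simpa [partialDeg] using HomogList.nil
  | succ i ih =>
    rw [partialDeg, sum_range_succ, ← partialDeg]
    by_cases h : i < n
    · rw [dif_pos h, List.take_add_one, List.getElem?_eq_getElem (by simpa using h)]
      refine ih.append ?_
      simpa using HomogList.nil.cons (hv ⟨i, h⟩)
    · rw [dif_neg h, add_zero, List.take_of_length_le (by simp; omega)]
      rwa [List.take_of_length_le (by simp; omega)] at ih

theorem homogList_ofFn {n : ℕ} {p : Fin n → ℤ} {v : Fin n → M} (hv : ∀ t, v t ∈ gr (p t)) :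
    HomogList gr (List.ofFn v) (∑ t, p t) := by
  have h := homogList_take hv n
  rw [List.take_of_length_le (by simp)] at h
  simpa [partialDeg, Finset.sum_range] using h

theorem HomogList.exists_degrees {l : List M} {p : ℤ} (hl : HomogList gr l p) :
    ∃ (v : Fin l.length → M) (q : Fin l.length → ℤ),
      List.ofFn v = l ∧ (∀ t, v t ∈ gr (q t)) ∧ ∑ t, q t = p := by
  induction hl with
  | nil => exact ⟨Fin.elim0, Fin.elim0, by simp, fun t => t.elim0, by simp⟩
  | @cons x l p q hx _ ih =>
    obtain ⟨v, e, hv, he, hsum⟩ := ih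
    refine ⟨Fin.cons x v, Fin.cons p e, by simp [List.ofFn_succ, hv], fun t => ?_, ?_⟩
    · refine Fin.cases ?_ (fun t => ?_) t
      · simpa using hx
      · simpa using he t
    · simp [Fin.sum_univ_succ, hsum]

theorem coderiv_word {σ : M →ₗ[k] M} (hσ : IsSign gr σ) {b : TensorAlgebra k M →ₗ[k] M}
    (hb : b 1 = 0) (X : TensorAlgebra k M →ₗ[k] P) {n : ℕ} {p : Fin n → ℤ} {v : Fin n → M}
    (hv : ∀ t, v t ∈ gr (p t)) :
    X (coderiv σ b (word (List.ofFn v))) = ∑ i ∈ range n, ∑ j ∈ Icc 1 (n - i),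
      ((-1 : k) ^ partialDeg n i p) •
        X (word (List.ofFn (insArg n i j v (b (word (List.ofFn (shiftArg n i j v))))))) := by
  rw [coderiv, conv_word, List.length_ofFn, sum_range_succ]
  have last : ((ι k ∘ₗ b) ⋆ LinearMap.id) (word ((List.ofFn v).drop n)) = 0 := by
    rw [List.drop_of_length_le (by simp), word_nil, conv_one_apply]
    simp [hb]
  rw [last, mul_zero, add_zero, map_sum]
  refine sum_congr rfl fun i hi => ?_
  have hi := mem_range.mp hi
  rw [conv_word, sum_range_succ', List.take_zero, word_nil, LinearMap.comp_apply, hb, map_zero,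
    zero_mul, add_zero, mul_sum, map_sum, List.length_drop, List.length_ofFn]
  refine sum_nbij' (· + 1) (· - 1) ?_ ?_ ?_ ?_ ?_
  · intro j hj; simp only [mem_range, mem_Icc] at hj ⊢; omega
  · intro j hj; simp only [mem_range, mem_Icc] at hj ⊢; omega
  · intro j hj; rfl
  · intro j hj; simp only [mem_Icc] at hj; omega
  · intro j hj
    have hj := mem_range.mp hj
    have hs : (tmap σ).toLinearMap (word ((List.ofFn v).take i)) =
        (-1 : k) ^ partialDeg n i p • word ((List.ofFn v).take i) :=
      isSign_tmap hσ _ _ (word_mem_tensorGrading (homogList_take hv i))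
    rw [hs, ofFn_insArg hi (by omega) (by omega), ofFn_shiftArg (by omega), word_append,
      word_cons, smul_mul_assoc, map_smul]
    rfl

theorem sum_composition_succ {n : ℕ} (F : List ℕ → P) :
    ∑ c : Composition (n + 1), F c.blocks =
      ∑ i ∈ range (n + 1), ∑ c : Composition (n - i), F ((i + 1) :: c.blocks) := by
  rw [Finset.sum_sigma']
  symm
  refine sum_bij (fun x hx => ⟨(x.1 + 1) :: x.2.blocks, ?_, ?_⟩) (fun _ _ => mem_univ _) ?_ ?_
    fun _ _ => rfl
  · intro i hi
    rcases List.mem_cons.mp hi with rfl | hi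
    · omega
    · exact x.2.blocks_pos hi
  · have := mem_range.mp (mem_sigma.mp hx).1
    rw [List.sum_cons, x.2.blocks_sum]
    omega
  · rintro ⟨i, c⟩ _ ⟨i', c'⟩ _ h
    have h := List.cons_eq_cons.mp (congrArg Composition.blocks h)
    obtain rfl : i = i' := by simpa using h.1
    rw [show c = c' from Composition.ext h.2]
  · rintro ⟨_ | ⟨a, bs⟩, hpos, hsum⟩ _
    · simp at hsum
    · have ha : 0 < a := hpos (by simp)
      rw [List.sum_cons] at hsum
      obtain ⟨i, rfl⟩ := Nat.exists_eq_succ_of_ne_zero ha.ne'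
      exact ⟨⟨i, ⟨bs, fun h => hpos (List.mem_cons_of_mem _ h), by omega⟩⟩,
        by simp; omega, rfl⟩

theorem geom_word {φ : TensorAlgebra k M →ₗ[k] N} (hφ : φ 1 = 0) {n : ℕ} {l : List M}
    (hl : l.length = n) :
    geom φ (word l) = ∑ c : Composition n,
      word ((l.splitWrtCompositionAux c.blocks).map fun l' => φ (word l')) := by
  induction n using Nat.strong_induction_on generalizing l with
  | _ n ih =>
    cases n with
    | zero =>
      obtain rfl := List.length_eq_zero_iff.mp hl
      have hc : ∀ c : Composition 0, c.blocks = [] := fun c => c.blocks_eq_nil.mpr rfl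
      simp [geom_one hφ, hc, List.splitWrtCompositionAux, composition_card]
    | succ n =>
      rw [geom_eq hφ, LinearMap.add_apply, conv_word, hl, sum_range_succ', List.take_zero,
        word_nil, LinearMap.comp_apply, hφ, map_zero, zero_mul, add_zero]
      obtain ⟨x, t, rfl⟩ := List.exists_cons_of_length_eq_add_one hl
      rw [convUnit_word_cons, zero_add, sum_composition_succ fun b =>
        word (((x :: t).splitWrtCompositionAux b).map fun l' => φ (word l'))]
      refine sum_congr rfl fun i hi => ?_
      rw [ih (n - i) (by omega) (by simp at hl ⊢; omega), mul_sum]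
      refine sum_congr rfl fun c _ => ?_
      rw [List.splitWrtCompositionAux_cons, List.map_cons, word_cons]
      rfl

theorem geom_word_ofFn {φ : TensorAlgebra k M →ₗ[k] N} (hφ : φ 1 = 0) {n : ℕ} (v : Fin n → M) :
    geom φ (word (List.ofFn v)) = ∑ c : Composition n,
      word (List.ofFn fun s => φ (word (List.ofFn fun t => v (c.embedding s t)))) := by
  rw [geom_word hφ (List.length_ofFn (f := v))]
  refine sum_congr rfl fun c _ => congrArg word ?_
  refine List.ext_getElem ?_ fun s h1 h2 => ?_
  · rw [List.length_map, List.length_ofFn]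
    exact List.length_splitWrtComposition _ _
  · rw [List.getElem_map, List.getElem_ofFn]
    refine congrArg (φ ∘ word) ?_
    rw [List.length_ofFn] at h2
    have h3 := c.sizeUpTo_succ' ⟨s, h2⟩
    have h4 := c.sizeUpTo_le (s + 1)
    refine (List.getElem_splitWrtComposition' (List.ofFn v) c _).trans ?_
    simp only at h3
    refine List.ext_getElem (by simp; omega) fun t h5 h6 => ?_
    simp only [List.getElem_drop, List.getElem_take, List.getElem_ofFn]
    rfl

/-- Restricting a linear map on the tensor algebra to words of fixed length is multilinear. -/
theorem isMultilinear_word (X : TensorAlgebra k M →ₗ[k] N) (n : ℕ) :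
    IsMultilinear k fun v : Fin n → M => X (word (List.ofFn v)) := by
  simp only [← tprod_eq_word]
  exact ⟨fun v i x y => by simp, fun v i a x => by simp⟩

theorem exists_word_eq {b : ∀ n : ℕ, (Fin n → M) → N} (hb : ∀ n, IsMultilinear k (b n)) :
    ∃ X : TensorAlgebra k M →ₗ[k] N, ∀ n v, X (word (List.ofFn v)) = b n v := by
  let B : ∀ n, MultilinearMap k (fun _ : Fin n => M) N := fun n =>
    { toFun := b n
      map_update_add' := fun {inst} v i x y => by
        rw [Subsingleton.elim inst (instDecidableEqFin n)]; exact (hb n).1 v i x y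
      map_update_smul' := fun {inst} v i a x => by
        rw [Subsingleton.elim inst (instDecidableEqFin n)]; exact (hb n).2 v i a x }
  refine ⟨DirectSum.toModule k ℕ N (fun n => PiTensorProduct.lift (B n)) ∘ₗ
    (TensorAlgebra.equivDirectSum (R := k) (M := M)).toLinearMap, fun n v => ?_⟩
  have h := TensorAlgebra.toDirectSum_tensorPower_tprod (R := k) v
  rw [tprod_eq_word] at h
  simp only [LinearMap.comp_apply, AlgEquiv.toLinearMap_apply]
  erw [h]
  exact (DirectSum.toModule_lof k n _).trans (PiTensorProduct.lift.tprod v)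

theorem coderiv_ι (σ : M →ₗ[k] M) {b : TensorAlgebra k M →ₗ[k] M} (hb : b 1 = 0) (x : M) :
    coderiv σ b (ι k x) = ι k (b (ι k x)) := by
  have h := conv_word (tmap σ).toLinearMap ((ι k ∘ₗ b) ⋆ LinearMap.id) [x]
  simp only [word_cons, word_nil, mul_one] at h
  rw [coderiv, h]
  have h' := conv_word (ι k ∘ₗ b) LinearMap.id [x]
  simp only [word_cons, word_nil, mul_one] at h'
  simp [sum_range_succ, h', hb, conv_one_apply]

theorem isInternal_shift {G : ℤ → Submodule k M} (hG : DirectSum.IsInternal G) :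
    DirectSum.IsInternal fun p => G (p + 1) := by
  rw [DirectSum.isInternal_submodule_iff_iSupIndep_and_iSup_eq_top] at hG ⊢
  exact ⟨hG.1.comp (add_left_injective 1), (Equiv.addRight (1 : ℤ)).iSup_comp.trans hG.2⟩

theorem IsHomog.apply_word {G : ℤ → Submodule k N} {c : ℤ} {X : TensorAlgebra k M →ₗ[k] N}
    (hX : IsHomog (tensorGrading gr) G c X) {n : ℕ} {p : Fin n → ℤ} {v : Fin n → M}
    (hv : ∀ t, v t ∈ gr (p t)) : X (word (List.ofFn v)) ∈ G (∑ t, p t + c) :=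
  hX _ _ (word_mem_tensorGrading (homogList_ofFn hv))

theorem isAInfinity_word {σ : M →ₗ[k] M} (hσ : IsSign gr σ) {b : TensorAlgebra k M →ₗ[k] M}
    (b_one : b 1 = 0) (hb : IsHomog (tensorGrading gr) gr 1 b)
    (square : ∀ t, b (coderiv σ b t) = 0) :
    IsAInfinity k M gr fun _ v => b (word (List.ofFn v)) := by
  refine ⟨?_, isMultilinear_word b, fun _ _ _ hv => ?_, fun _ _ _ _ hv => ?_⟩
  · funext v
    simpa using b_one
  · rw [add_comm]
    exact hb.apply_word hv
  · rw [← coderiv_word hσ b_one b hv, square]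

theorem isHomog_of_ofFn {G : ℤ → Submodule k N} {c : ℤ} {X : TensorAlgebra k M →ₗ[k] N}
    (h : ∀ (n : ℕ) (p : Fin n → ℤ) (v : Fin n → M), (∀ t, v t ∈ gr (p t)) →
      X (word (List.ofFn v)) ∈ G (∑ t, p t + c)) : IsHomog (tensorGrading gr) G c X := by
  refine isHomog_of_word fun l p hl => ?_
  obtain ⟨v, q, hv, hq, rfl⟩ := hl.exists_degrees
  simpa only [hv] using h _ q v hq

theorem square_of_isAInfinity (hgr : ⨆ p, gr p = ⊤) {σ : M →ₗ[k] M} (hσ : IsSign gr σ)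
    {b : ∀ n : ℕ, (Fin n → M) → M} (hb : IsAInfinity k M gr b) {X : TensorAlgebra k M →ₗ[k] M}
    (hX : ∀ n v, X (word (List.ofFn v)) = b n v) (X_one : X 1 = 0) (t : TensorAlgebra k M) :
    X (coderiv σ X t) = 0 := by
  have h : IsHomog (tensorGrading gr) (fun _ => ⊥) 0 (X ∘ₗ coderiv σ X) :=
    isHomog_of_ofFn fun n _ v hv => by
      rw [Submodule.mem_bot, LinearMap.comp_apply, coderiv_word hσ X_one X hv]
      rcases n.eq_zero_or_pos with rfl | hn
      · simp
      · simpa only [hX] using hb.2.2.2 n hn _ v hv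
  exact LinearMap.congr_fun (ext_of_iSup_eq_top (iSup_tensorGrading hgr) (Y := 0) h) t

end Translation

/-- **Statement 12.** -/
theorem extend_structure_along_quasi_isomorphism
    (A : AInfAlg k)
    -- the complex `V`:
    (MV : Type) [AddCommGroup MV] [Module k MV] (grV : ℤ → Submodule k MV)
    (internalV : DirectSum.IsInternal grV)
    (dV : MV →ₗ[k] MV)
    (hdVdeg : ∀ (p : ℤ) (x : MV), x ∈ grV p → dV x ∈ grV (p + 1))
    (hdVsq : ∀ x, dV (dV x) = 0)
    -- `f₁ : A → V`, a morphism of complexes homogeneous of degree `0`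
    -- (recall `m₁ = -b₁` is the differential of `A`):
    (f₁ : A.M →ₗ[k] MV)
    (hf₁deg : ∀ (p : ℤ) (x : A.M), x ∈ A.gr p → f₁ x ∈ grV (p + 1))
    (hf₁chain : ∀ x : A.M, f₁ (A.b 1 fun _ => x) = - dV (f₁ x))
    -- `f₁` is a quasi-isomorphism: it induces a bijection in homology, i.e. it is
    -- surjective on homology …
    (hsurj : ∀ (p : ℤ) (y : MV), y ∈ grV p → dV y = 0 →
      ∃ x ∈ A.gr (p - 1), A.b 1 (fun _ => x) = 0 ∧
        ∃ z ∈ grV (p - 1), f₁ x - y = dV z)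
    -- … and injective on homology:
    (hinj : ∀ (p : ℤ) (x : A.M), x ∈ A.gr p → A.b 1 (fun _ => x) = 0 →
      (∃ w ∈ grV p, f₁ x = dV w) →
      ∃ z ∈ A.gr (p - 1), x = A.b 1 fun _ => z) :
    -- conclusion: `V` carries an A∞-structure with `b₁ = -d_V` and `f₁` extends to an
    -- A∞-(quasi-iso)morphism with first component `f₁`:
    ∃ bV : ∀ n : ℕ, (Fin n → MV) → MV,
      IsAInfinity k MV (fun p => grV (p + 1)) bV ∧
      (∀ v : Fin 1 → MV, bV 1 v = - dV (v 0)) ∧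
      ∃ f : ∀ n : ℕ, (Fin n → A.M) → MV,
        IsAInfMorphism k A.M A.gr A.b MV (fun p => grV (p + 1)) bV f ∧
        (∀ v : Fin 1 → A.M, f 1 v = f₁ (v 0)) := by
  have tA := iSup_eq_top_of_isInternal A.internal
  have internalV' := isInternal_shift internalV
  obtain ⟨b_zero, b_multilinear, b_degree, -⟩ := A.isAInf
  obtain ⟨b, hb⟩ := exists_word_eq b_multilinear
  have b_one : b 1 = 0 := by simpa [b_zero] using hb 0 Fin.elim0
  have b_homog : IsHomog (tensorGrading A.gr) A.gr 1 b := isHomog_of_ofFn fun n p v hv => by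
    rw [hb, add_comm]
    exact b_degree n p v hv
  have b_ι : ∀ x, b (TensorAlgebra.ι k x) = A.b 1 fun _ => x := fun x => by
    rw [← hb]
    simp
  obtain ⟨σ, hσ⟩ := exists_isSign A.internal
  obtain ⟨τ, hτ⟩ := exists_isSign internalV'
  have square := square_of_isAInfinity tA hσ A.isAInf hb b_one
  set d : A.M →ₗ[k] A.M := b ∘ₗ TensorAlgebra.ι k with hd
  have d_apply : ∀ x, d x = A.b 1 fun _ => x := b_ι
  have d_homog : IsHomog A.gr A.gr 1 d := b_homog.comp ι_isHomog (zero_add 1)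
  have d_d : ∀ x, d (d x) = 0 := fun x => by
    have := square (TensorAlgebra.ι k x)
    rwa [coderiv_ι σ b_one] at this
  have dN_homog : IsHomog (fun p => grV (p + 1)) (fun p => grV (p + 1)) 1 (-dV) :=
    fun p x hx => Submodule.neg_mem _ (hdVdeg _ x hx)
  have dN_dN : ∀ x, (-dV) ((-dV) x) = 0 := fun x => by simp [hdVsq]
  have f_homog : IsHomog A.gr (fun p => grV (p + 1)) 0 f₁ := fun p x hx => by
    rw [add_zero]
    exact hf₁deg p x hx
  have f_d : ∀ x, f₁ (d x) = (-dV) (f₁ x) := fun x => by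
    rw [d_apply, hf₁chain, LinearMap.neg_apply]
  obtain ⟨g, h, g_homog, h_homog, d_g, d_h⟩ :=
    exists_homotopy_inverse A.internal internalV' d_homog dN_homog f_homog d_d
      (by
        rintro p x hx hdx ⟨w, hw, hxw⟩
        obtain ⟨z, -, hz⟩ := hinj p x hx (by rw [← d_apply, hdx])
          ⟨-w, Submodule.neg_mem _ (by simpa using hw), by simpa using hxw⟩
        exact ⟨z, by rw [d_apply, hz]⟩)
  have split : d ∘ₗ TensorAlgebra.ιInv + (b - d ∘ₗ TensorAlgebra.ιInv) = b := add_sub_cancel _ _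
  have D : TransferDatum A.gr (fun p => grV (p + 1)) σ τ d (b - d ∘ₗ TensorAlgebra.ιInv)
      (-dV) f₁ g h :=
    { iSup_gr := tA
      iSup_gr' := iSup_eq_top_of_isInternal internalV'
      sign := hσ
      sign' := hτ
      d_homog := d_homog
      β_homog := fun p x hx => Submodule.sub_mem _ (b_homog p x hx)
        (d_homog.comp ιInv_isHomog (zero_add 1) p x hx)
      dN_homog := dN_homog
      f_homog := f_homog
      g_homog := g_homog
      h_homog := h_homog
      d_d := d_d
      dN_dN := dN_dN
      f_d := f_d
      d_g := d_g
      d_h := d_h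
      β_one := by simp [b_one, ιInv_one]
      β_ι := by
        ext x
        simp [ιInv_ι, hd]
      square := by rwa [split] }
  obtain ⟨ν, φ, ν_one, φ_one, hν, hφ, ν_square, φ_ν, ν_ι, φ_ι⟩ := D.exists_transfer
  rw [split] at φ_ν
  refine ⟨fun n v => ν (word (List.ofFn v)), isAInfinity_word hτ ν_one hν ν_square, fun v => ?_,
    fun n v => φ (word (List.ofFn v)),
    ⟨?_, isMultilinear_word φ, fun n p v hv => ?_, fun n _ p v hv => ?_⟩, fun v => ?_⟩
  · simp [ν_ι]
  · funext v
    simpa using φ_one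
  · simpa using hφ.apply_word hv
  · simp only [← hb]
    rw [← coderiv_word hσ b_one φ hv, φ_ν, geom_word_ofFn φ_one, map_sum]
  · simp [φ_ι]

end Stmt12
end
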